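/- arXiv:2402.11884 — 7 statements merged into one kernel-verified Lean document; each statement's English description precedes it below -/
import Mathlib

section
/- Suppose the sequence (a_n) of nonnegative reals is regular, has level of distribution ϑ with density g for some ϑ ∈ (0,1], and is locally uniform. Then there exists a constant K > 0, depending only on the sequence (a_n), such that for every ε > 0: limsup_{x→∞} (1/N(x)) · ∑_{n ≤ x, P^+(n) ≥ n^{1−ε}} a_n ≤ K·ε. -/
open Finset Filter Real

open scoped Classical

/-- `N a x = ∑_{1 ≤ n ≤ x} a n`. -/
noncomputable def N (a : ℕ → ℝ) (x : ℝ) : ℝ := ∑ n ∈ Finset.Icc 1 ⌊x⌋₊, a n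

/-- `Nd a d x = ∑_{1 ≤ n ≤ x, d ∣ n} a n`. -/
noncomputable def Nd (a : ℕ → ℝ) (d : ℕ) (x : ℝ) : ℝ :=
  ∑ n ∈ (Finset.Icc 1 ⌊x⌋₊).filter (fun n => d ∣ n), a n

/-- `Ω n`: number of prime factors of `n` counted with multiplicity. -/
def bigOmega (n : ℕ) : ℕ := n.primeFactorsList.length

/-- Regularity: for each fixed `0 < c < 1`, `N(x^c) = o(N(x))` as `x → ∞`. -/
def Regular (a : ℕ → ℝ) : Prop :=
  ∀ c : ℝ, 0 < c → c < 1 →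
    (fun x : ℝ => N a (x ^ c)) =o[atTop] fun x : ℝ => N a x

/-- `g` is multiplicative: `g 1 = 1` and `g (m n) = g m * g n` for coprime `m, n`. -/
def MultOn (g : ℕ → ℝ) : Prop :=
  g 1 = 1 ∧ ∀ m n : ℕ, Nat.Coprime m n → g (m * n) = g m * g n

/-- `(a n)` has level of distribution `ϑ` with density `g`. -/
def HasLevel (a : ℕ → ℝ) (ϑ : ℝ) (g : ℕ → ℝ) : Prop :=
  MultOn g ∧
  (∀ d : ℕ, 1 ≤ d → g d ∈ Set.Icc (0:ℝ) 1) ∧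
  (∃ M : ℝ, ∀ x : ℝ, 2 ≤ x →
      |(∑ p ∈ (Finset.Icc 1 ⌊x⌋₊).filter Nat.Prime, g p * Real.log p) - Real.log x| ≤ M) ∧
  (∃ C : ℝ, 1 ≤ C ∧ ∃ K : ℝ, ∀ d : ℕ, 1 ≤ d → g d ≤ K * C ^ bigOmega d / d) ∧
  (∀ c : ℝ, 0 < c → c < ϑ → ∀ A : ℝ, 0 < A → ∃ K : ℝ, ∀ x : ℝ, 2 ≤ x →
      ∑ d ∈ Finset.Icc 1 ⌊x ^ c⌋₊, |Nd a d x - g d * N a x| ≤ K * N a x / Real.log x ^ A)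

/-- Local uniformity with explicit parameters `δ`, `B`, `C`. -/
def LocallyUniformWith (a : ℕ → ℝ) (δ B C : ℝ) : Prop :=
  ∃ K : ℝ, ∀ x : ℝ, 2 ≤ x → ∀ d : ℕ, 1 ≤ d → (d : ℝ) ≤ x ^ δ →
    Nd a d x ≤ K * Real.log x ^ B * C ^ bigOmega d * N a x / d

/-- Local uniformity: some parameters `δ > 0`, `B ≥ 0`, `C ≥ 1` work. -/
def LocallyUniform (a : ℕ → ℝ) : Prop :=
  ∃ δ : ℝ, 0 < δ ∧ ∃ B : ℝ, 0 ≤ B ∧ ∃ C : ℝ, 1 ≤ C ∧ LocallyUniformWith a δ B C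

/-- The `j`-th largest prime factor of `n` (with multiplicity), `1` if `n` has fewer
than `j` prime factors.  (Indexing: `j ≥ 1`.) -/
def nthPF (n j : ℕ) : ℕ :=
  (n.primeFactorsList.mergeSort (fun p q => decide (q ≤ p))).getD (j - 1) 1

/-- `log p / log n`, with the convention that this is `1` when `n = 1`. -/
noncomputable def logRatio (n p : ℕ) : ℝ := if n = 1 then 1 else Real.log p / Real.log n

/-- The largest prime factor `P⁺(n)`, with `P⁺(1) = 1`. -/
def Pplus (n : ℕ) : ℕ := n.primeFactorsList.foldr max 1

/-- The number of roots of `F` modulo `d`. -/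
def rootCount (F : Polynomial ℤ) (d : ℕ) : ℕ :=
  ((Finset.range d).filter (fun r : ℕ => (d:ℤ) ∣ F.eval (r:ℤ))).card

noncomputable def lamD (P : Finset ℕ) (h : ℕ → ℝ) (y : ℝ) : Finset (Finset ℕ) :=
  P.powerset.filter (fun D => ((∏ p ∈ D, p : ℕ) : ℝ) ≤ y)

noncomputable def lamS (P : Finset ℕ) (h : ℕ → ℝ) (y : ℝ) : ℝ :=
  ∑ D ∈ lamD P h y, ∏ p ∈ D, h p

noncomputable def lamW (P : Finset ℕ) (h : ℕ → ℝ) (y : ℝ) (e : Finset ℕ) : ℝ :=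
  ∑ D ∈ (lamD P h y).filter (fun D => e ⊆ D), (∏ p ∈ e, (-(1 + h p))) * ∏ p ∈ D \ e, h p

noncomputable def lamF (P : Finset ℕ) (h : ℕ → ℝ) (y : ℝ) (T : Finset ℕ) : ℝ :=
  ∑ D ∈ lamD P h y, ∏ p ∈ D, (if p ∈ T then -1 else h p)

lemma lamD_down {P : Finset ℕ} {h : ℕ → ℝ} {y : ℝ} (hP : ∀ p ∈ P, Nat.Prime p)
    {D e : Finset ℕ} (hD : D ∈ lamD P h y) (he : e ⊆ D) : e ∈ lamD P h y := by
  simp only [lamD, Finset.mem_filter, Finset.mem_powerset] at hD ⊢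
  refine ⟨he.trans hD.1, le_trans ?_ hD.2⟩
  exact_mod_cast Finset.prod_le_prod_of_subset_of_one_le' he
    (fun i hi _ => (hP i (hD.1 hi)).one_lt.le)

lemma lamF_eq {P : Finset ℕ} {h : ℕ → ℝ} {y : ℝ} (hP : ∀ p ∈ P, Nat.Prime p) (T : Finset ℕ) :
    lamF P h y T = ∑ e ∈ lamD P h y, lamW P h y e * (if e ⊆ T then 1 else 0) := by
  have h1 : ∀ D ∈ lamD P h y, ∏ p ∈ D, (if p ∈ T then -1 else h p)
      = ∑ e ∈ lamD P h y, (if e ⊆ D then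
        ((∏ p ∈ e, (-(1 + h p))) * ∏ p ∈ D \ e, h p) * (if e ⊆ T then 1 else 0) else 0) := by
    intro D hD
    have : ∏ p ∈ D, (if p ∈ T then -1 else h p)
        = ∏ p ∈ D, ((-(1 + h p)) * (if p ∈ T then 1 else 0) + h p) := by
      apply Finset.prod_congr rfl
      intro p _
      split_ifs <;> ring
    rw [this, Finset.prod_add, ← Finset.sum_filter]
    have hs : (lamD P h y).filter (fun e => e ⊆ D) = D.powerset := by
      ext e
      simp only [Finset.mem_filter, Finset.mem_powerset]
      exact ⟨fun h => h.2, fun h => ⟨lamD_down hP hD h, h⟩⟩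
    rw [hs]
    apply Finset.sum_congr rfl
    intro e _
    rw [Finset.prod_mul_distrib]
    have : (∏ p ∈ e, (if p ∈ T then (1:ℝ) else 0)) = if e ⊆ T then 1 else 0 := by
      rw [Finset.prod_ite_zero]
      simp [Finset.subset_iff]
    rw [this]; ring
  unfold lamF
  rw [Finset.sum_congr rfl h1, Finset.sum_comm]
  apply Finset.sum_congr rfl
  intro e _
  rw [lamW, Finset.sum_mul, Finset.sum_filter]

lemma lamF_sq {P : Finset ℕ} {h : ℕ → ℝ} {y : ℝ} (hP : ∀ p ∈ P, Nat.Prime p) (T : Finset ℕ) :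
    lamF P h y T ^ 2 = ∑ e ∈ lamD P h y, ∑ e' ∈ lamD P h y,
      lamW P h y e * lamW P h y e' * (if e ∪ e' ⊆ T then 1 else 0) := by
  rw [lamF_eq hP, sq, Finset.sum_mul_sum]
  apply Finset.sum_congr rfl
  intro e _
  apply Finset.sum_congr rfl
  intro e' _
  by_cases h1 : e ⊆ T <;> by_cases h2 : e' ⊆ T <;> simp [h1, h2, Finset.union_subset_iff]

noncomputable def muT (P : Finset ℕ) (g : ℕ → ℝ) (T : Finset ℕ) : ℝ :=
  (∏ p ∈ T, g p) * ∏ p ∈ P \ T, (1 - g p)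

lemma muT_sub {P : Finset ℕ} {g : ℕ → ℝ} {E : Finset ℕ} (hE : E ⊆ P) :
    ∑ T ∈ P.powerset, muT P g T * (if E ⊆ T then 1 else 0) = ∏ p ∈ E, g p := by
  have h1 : ∏ p ∈ P, (g p + (if p ∈ E then 0 else (1 - g p))) = ∏ p ∈ E, g p := by
    rw [← Finset.prod_subset hE (f := fun p => g p + (if p ∈ E then 0 else (1 - g p)))]
    · apply Finset.prod_congr rfl
      intro p hp; simp [hp]
    · intro p _ hp; simp [hp]
  rw [← h1, Finset.prod_add]
  apply Finset.sum_congr rfl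
  intro T hT
  rw [Finset.mem_powerset] at hT
  rw [muT, mul_assoc]
  congr 1
  by_cases h : E ⊆ T
  · simp only [h, if_true, mul_one]
    apply Finset.prod_congr rfl
    intro p hp
    rw [if_neg]
    intro h'; exact (Finset.mem_sdiff.1 hp).2 (h h')
  · simp only [h, if_false, mul_zero]
    obtain ⟨p, hp, hp'⟩ := Finset.not_subset.1 h
    symm
    apply Finset.prod_eq_zero (i := p) (Finset.mem_sdiff.2 ⟨hE hp, hp'⟩)
    simp [hp]

lemma muT_orth {P : Finset ℕ} {g h : ℕ → ℝ} (hgh : ∀ p ∈ P, g p * (1 + h p) = h p)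
    {D D' : Finset ℕ} (hD : D ⊆ P) (hD' : D' ⊆ P) :
    ∑ T ∈ P.powerset, muT P g T * ((∏ p ∈ D, (if p ∈ T then -1 else h p)) *
      ∏ p ∈ D', (if p ∈ T then -1 else h p)) = if D = D' then ∏ p ∈ D, h p else 0 := by
  have key : ∀ T ∈ P.powerset, ∀ D ⊆ P, ∏ p ∈ D, (if p ∈ T then -1 else h p) =
      (∏ p ∈ T, if p ∈ D then -1 else 1) * ∏ p ∈ P \ T, if p ∈ D then h p else 1 := by
    intro T hT D hD
    rw [Finset.mem_powerset] at hT
    have e1 : ∏ p ∈ D, (if p ∈ T then -1 else h p) =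
        ∏ p ∈ P, (if p ∈ D then (if p ∈ T then -1 else h p) else 1) := by
      rw [← Finset.prod_filter]
      congr 1
      ext p; simp only [Finset.mem_filter]; exact ⟨fun h => ⟨hD h, h⟩, fun h => h.2⟩
    rw [e1, ← Finset.prod_sdiff hT, mul_comm]
    congr 1
    · apply Finset.prod_congr rfl
      intro p hp; simp [hp]
    · apply Finset.prod_congr rfl
      intro p hp; simp [(Finset.mem_sdiff.1 hp).2]
  have h1 : ∑ T ∈ P.powerset, muT P g T * ((∏ p ∈ D, (if p ∈ T then -1 else h p)) *
      ∏ p ∈ D', (if p ∈ T then -1 else h p)) =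
      ∏ p ∈ P, (g p * ((if p ∈ D then -1 else 1) * (if p ∈ D' then -1 else 1)) +
        (1 - g p) * ((if p ∈ D then h p else 1) * (if p ∈ D' then h p else 1))) := by
    rw [Finset.prod_add]
    apply Finset.sum_congr rfl
    intro T hT
    rw [key T hT D hD, key T hT D' hD', muT]
    simp only [Finset.prod_mul_distrib]
    ring
  rw [h1]
  split_ifs with hDD
  · subst hDD
    rw [← Finset.prod_subset hD (f := fun p => (g p * ((if p ∈ D then -1 else 1) *
        (if p ∈ D then -1 else 1)) +
        (1 - g p) * ((if p ∈ D then h p else 1) * (if p ∈ D then h p else 1))))]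
    · apply Finset.prod_congr rfl
      intro p hp
      simp only [hp, if_true]
      linear_combination (1 - h p) * hgh p (hD hp)
    · intro p _ hp; simp [hp]
  · have : ∃ p ∈ P, ¬ (p ∈ D ↔ p ∈ D') := by
      by_contra hc
      push Not at hc
      apply hDD
      ext p
      exact ⟨fun h => (hc p (hD h)).1 h, fun h => (hc p (hD' h)).2 h⟩
    obtain ⟨p, hp, hne⟩ := this
    apply Finset.prod_eq_zero hp
    have := hgh p hp
    by_cases h1 : p ∈ D <;> by_cases h2 : p ∈ D' <;> simp [h1, h2] at hne ⊢ <;> linarith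

lemma main_term {P : Finset ℕ} {g h : ℕ → ℝ} {y : ℝ} (hP : ∀ p ∈ P, Nat.Prime p)
    (hgh : ∀ p ∈ P, g p * (1 + h p) = h p) :
    ∑ e ∈ lamD P h y, ∑ e' ∈ lamD P h y, lamW P h y e * lamW P h y e' * ∏ p ∈ e ∪ e', g p
      = lamS P h y := by
  have hsub : ∀ D ∈ lamD P h y, D ⊆ P := by
    intro D hD; simp only [lamD, Finset.mem_filter, Finset.mem_powerset] at hD; exact hD.1
  have h1 : ∑ T ∈ P.powerset, muT P g T * lamF P h y T ^ 2 = lamS P h y := by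
    have : ∀ T, muT P g T * lamF P h y T ^ 2 = ∑ D ∈ lamD P h y, ∑ D' ∈ lamD P h y,
        muT P g T * ((∏ p ∈ D, (if p ∈ T then -1 else h p)) *
      ∏ p ∈ D', (if p ∈ T then -1 else h p)) := by
      intro T
      rw [lamF, sq, Finset.sum_mul_sum, Finset.mul_sum]
      simp only [Finset.mul_sum]
    simp only [this]
    rw [Finset.sum_comm, lamS]
    apply Finset.sum_congr rfl
    intro D hD
    rw [Finset.sum_comm, Finset.sum_congr rfl
      (fun D' hD' => muT_orth hgh (hsub D hD) (hsub D' hD'))]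
    simp [hD]
  rw [← h1]
  simp only [lamF_sq hP, Finset.mul_sum]
  symm
  rw [Finset.sum_comm]
  apply Finset.sum_congr rfl
  intro e he
  rw [Finset.sum_comm]
  apply Finset.sum_congr rfl
  intro e' he'
  rw [← muT_sub (Finset.union_subset (hsub e he) (hsub e' he')), Finset.mul_sum]
  apply Finset.sum_congr rfl
  intro T _
  ring

lemma lamW_bound {P : Finset ℕ} {h : ℕ → ℝ} {y : ℝ} (hP : ∀ p ∈ P, Nat.Prime p)
    (h0 : ∀ p ∈ P, 0 ≤ h p) (h1 : ∀ p ∈ P, h p ≤ 1) {k : ℕ}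
    (hk : ∀ D ∈ lamD P h y, D.card ≤ k) {e : Finset ℕ} (he : e ∈ lamD P h y) :
    |lamW P h y e| ≤ 2 ^ k * lamS P h y := by
  have hsub : ∀ D ∈ lamD P h y, D ⊆ P := by
    intro D hD; simp only [lamD, Finset.mem_filter, Finset.mem_powerset] at hD; exact hD.1
  rw [lamW, ← Finset.mul_sum, abs_mul]
  have a1 : |∏ p ∈ e, (-(1 + h p))| ≤ 2 ^ k := by
    rw [Finset.abs_prod]
    calc ∏ p ∈ e, |(-(1 + h p))| ≤ ∏ p ∈ e, (2:ℝ) := by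
          apply Finset.prod_le_prod
          · intros; positivity
          · intro p hp
            have := h0 p (hsub e he hp); have := h1 p (hsub e he hp)
            rw [abs_neg, abs_of_nonneg] <;> linarith
      _ = 2 ^ e.card := by simp
      _ ≤ 2 ^ k := pow_le_pow_right₀ (by norm_num) (hk e he)
  have hnn : ∀ D ∈ lamD P h y, 0 ≤ ∏ p ∈ D, h p :=
    fun D hD => Finset.prod_nonneg fun p hp => h0 p (hsub D hD hp)
  have a2 : ∑ D ∈ (lamD P h y).filter (fun D => e ⊆ D), ∏ p ∈ D \ e, h p ≤ lamS P h y := by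
    have hinj : Set.InjOn (fun D => D \ e) ((lamD P h y).filter (fun D => e ⊆ D) : Finset (Finset ℕ)) := by
      intro D hD D' hD' hh
      simp only [Finset.coe_filter, Set.mem_ofPred_eq] at hD hD' hh
      rw [← Finset.sdiff_union_of_subset hD.2, ← Finset.sdiff_union_of_subset hD'.2, hh]
    rw [← Finset.sum_image (f := fun D => ∏ p ∈ D, h p) hinj, lamS]
    apply Finset.sum_le_sum_of_subset_of_nonneg
    · intro D hD
      simp only [Finset.mem_image, Finset.mem_filter] at hD
      obtain ⟨D', ⟨hD', _⟩, rfl⟩ := hD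
      exact lamD_down hP hD' Finset.sdiff_subset
    · intro D hD _; exact hnn D hD
  have a3 : 0 ≤ ∑ D ∈ (lamD P h y).filter (fun D => e ⊆ D), ∏ p ∈ D \ e, h p := by
    apply Finset.sum_nonneg
    intro D hD
    exact Finset.prod_nonneg fun p hp =>
      h0 p (hsub D (Finset.mem_filter.1 hD).1 (Finset.sdiff_subset hp))
  rw [abs_of_nonneg a3]
  exact mul_le_mul a1 a2 a3 (by positivity)

lemma mult_prod {g : ℕ → ℝ} (hg : MultOn g) (E : Finset ℕ) (hE : ∀ p ∈ E, Nat.Prime p) :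
    g (∏ p ∈ E, p) = ∏ p ∈ E, g p := by
  induction E using Finset.induction_on with
  | empty => simpa using hg.1
  | insert p s hp ih =>
    rw [Finset.prod_insert hp, Finset.prod_insert hp, hg.2, ih]
    · intro q hq; exact hE q (Finset.mem_insert_of_mem hq)
    · apply Nat.Coprime.prod_right
      intro q hq
      rw [Nat.coprime_primes (hE p (Finset.mem_insert_self _ _))
        (hE q (Finset.mem_insert_of_mem hq))]
      rintro rfl; exact hp hq

lemma sub_iff_dvd {P E : Finset ℕ} (hP : ∀ p ∈ P, Nat.Prime p) (hE : E ⊆ P) (n : ℕ) :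
    E ⊆ P.filter (fun p => p ∣ n) ↔ (∏ p ∈ E, p) ∣ n := by
  constructor
  · intro h
    apply Finset.prod_primes_dvd
    · intro p hp; exact (hP p (hE hp)).prime
    · intro p hp; exact (Finset.mem_filter.1 (h hp)).2
  · intro h p hp
    exact Finset.mem_filter.2 ⟨hE hp, (Finset.dvd_prod_of_mem _ hp).trans h⟩

lemma pair_count {P : Finset ℕ} {h : ℕ → ℝ} {y : ℝ} (hP : ∀ p ∈ P, Nat.Prime p) (hy : 1 ≤ y)
    {k : ℕ} (hk : ∀ D ∈ lamD P h y, D.card ≤ k) (r : ℕ → ℝ) (hr : ∀ d, 0 ≤ r d) :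
    ∑ e ∈ lamD P h y, ∑ e' ∈ lamD P h y, r (∏ p ∈ e ∪ e', p)
      ≤ 16 ^ k * ∑ d ∈ Finset.Icc 1 ⌊y * y⌋₊, r d := by
  have hsub : ∀ D ∈ lamD P h y, D ⊆ P ∧ ((∏ p ∈ D, p : ℕ) : ℝ) ≤ y := by
    intro D hD; simpa only [lamD, Finset.mem_filter, Finset.mem_powerset] using hD
  rw [← Finset.sum_product']
  have hmap : ∀ i ∈ lamD P h y ×ˢ lamD P h y,
      (∏ p ∈ i.1 ∪ i.2, p) ∈ Finset.Icc 1 ⌊y * y⌋₊ := by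
    intro i hi
    rw [Finset.mem_product] at hi
    obtain ⟨s1, b1⟩ := hsub _ hi.1
    obtain ⟨s2, b2⟩ := hsub _ hi.2
    have hpos : ∀ s ⊆ P, 1 ≤ ∏ p ∈ s, p := fun s hs =>
      Finset.prod_pos (fun p hp => (hP p (hs hp)).pos)
    rw [Finset.mem_Icc]
    refine ⟨hpos _ (Finset.union_subset s1 s2), ?_⟩
    apply Nat.le_floor
    have e1 := Finset.prod_union_inter (s₁ := i.1) (s₂ := i.2) (f := fun p : ℕ => p)
    have e2 : ∏ p ∈ i.1 ∪ i.2, p ≤ (∏ p ∈ i.1, p) * ∏ p ∈ i.2, p := by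
      rw [← e1]
      exact Nat.le_mul_of_pos_right _ (hpos _ (Finset.inter_subset_left.trans s1))
    calc ((∏ p ∈ i.1 ∪ i.2, p : ℕ) : ℝ) ≤ (((∏ p ∈ i.1, p) * ∏ p ∈ i.2, p : ℕ) : ℝ) := by
          exact_mod_cast e2
      _ = ((∏ p ∈ i.1, p : ℕ) : ℝ) * ((∏ p ∈ i.2, p : ℕ) : ℝ) := by push_cast; rfl
      _ ≤ y * y := by gcongr
  rw [← Finset.sum_fiberwise_of_maps_to hmap, Finset.mul_sum]
  apply Finset.sum_le_sum
  intro d _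
  have hc : ((lamD P h y ×ˢ lamD P h y).filter
      (fun i => (∏ p ∈ i.1 ∪ i.2, p) = d)).card ≤ 16 ^ k := by
    rcases Finset.eq_empty_or_nonempty ((lamD P h y ×ˢ lamD P h y).filter
      (fun i => (∏ p ∈ i.1 ∪ i.2, p) = d)) with h0 | ⟨i0, hi0⟩
    · rw [h0]; simp
    · have hpf : ∀ i ∈ (lamD P h y ×ˢ lamD P h y).filter
          (fun i => (∏ p ∈ i.1 ∪ i.2, p) = d), i.1 ∪ i.2 = d.primeFactors := by
        intro i hi
        simp only [Finset.mem_filter, Finset.mem_product] at hi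
        rw [← hi.2, Nat.primeFactors_prod]
        intro p hp
        exact hP p (Finset.union_subset (hsub _ hi.1.1).1 (hsub _ hi.1.2).1 hp)
      have hcard : d.primeFactors.card ≤ 2 * k := by
        rw [← hpf i0 hi0]
        simp only [Finset.mem_filter, Finset.mem_product] at hi0
        have := hk _ hi0.1.1
        have := hk _ hi0.1.2
        have := Finset.card_union_le i0.1 i0.2
        omega
      calc _ ≤ (d.primeFactors.powerset ×ˢ d.primeFactors.powerset).card := by
            apply Finset.card_le_card
            intro i hi
            rw [Finset.mem_product, Finset.mem_powerset, Finset.mem_powerset, ← hpf i hi]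
            exact ⟨Finset.subset_union_left, Finset.subset_union_right⟩
        _ = 2 ^ d.primeFactors.card * 2 ^ d.primeFactors.card := by
            rw [Finset.card_product, Finset.card_powerset]
        _ ≤ 2 ^ (2 * k) * 2 ^ (2 * k) := by gcongr <;> norm_num
        _ = 16 ^ k := by rw [pow_mul, ← mul_pow]; norm_num
  calc _ = ∑ i ∈ (lamD P h y ×ˢ lamD P h y).filter
            (fun i => (∏ p ∈ i.1 ∪ i.2, p) = d), r d := by
        apply Finset.sum_congr rfl
        intro i hi
        rw [(Finset.mem_filter.1 hi).2]
    _ = ((lamD P h y ×ˢ lamD P h y).filter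
          (fun i => (∏ p ∈ i.1 ∪ i.2, p) = d)).card * r d := by
        rw [Finset.sum_const, nsmul_eq_mul]
    _ ≤ _ := by
        apply mul_le_mul_of_nonneg_right _ (hr d)
        exact_mod_cast hc

lemma lamS_one_le {P : Finset ℕ} {h : ℕ → ℝ} {y : ℝ} (hy : 1 ≤ y)
    (h0 : ∀ p ∈ P, 0 ≤ h p) : 1 ≤ lamS P h y := by
  have : (∅ : Finset ℕ) ∈ lamD P h y := by simp [lamD, hy]
  have := Finset.single_le_sum (f := fun D : Finset ℕ => ∏ p ∈ D, h p) (s := lamD P h y) ?_ this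
  · simpa [lamS] using this
  · intro D hD
    simp only [lamD, Finset.mem_filter, Finset.mem_powerset] at hD
    exact Finset.prod_nonneg fun p hp => h0 p (hD.1 hp)

lemma sieve_bound (a : ℕ → ℝ) (ha : ∀ n, 0 ≤ a n) (x : ℝ) {g h : ℕ → ℝ} (hg : MultOn g)
    {P : Finset ℕ} {y : ℝ} (hP : ∀ p ∈ P, Nat.Prime p) (hy : 1 ≤ y)
    (h0 : ∀ p ∈ P, 0 ≤ h p) (h1 : ∀ p ∈ P, h p ≤ 1)
    (hgh : ∀ p ∈ P, g p * (1 + h p) = h p) {k : ℕ}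
    (hk : ∀ D ∈ lamD P h y, D.card ≤ k) :
    ∑ n ∈ (Finset.Icc 1 ⌊x⌋₊).filter (fun n => ∀ p ∈ P, ¬ p ∣ n), a n ≤
      N a x / lamS P h y + 64 ^ k * ∑ d ∈ Finset.Icc 1 ⌊y * y⌋₊, |Nd a d x - g d * N a x| := by
  have hsub : ∀ D ∈ lamD P h y, D ⊆ P := by
    intro D hD; simp only [lamD, Finset.mem_filter, Finset.mem_powerset] at hD; exact hD.1
  set S := lamS P h y with hS
  have hS1 : 1 ≤ S := lamS_one_le hy h0
  set X := ∑ n ∈ (Finset.Icc 1 ⌊x⌋₊).filter (fun n => ∀ p ∈ P, ¬ p ∣ n), a n with hX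
  set R := ∑ d ∈ Finset.Icc 1 ⌊y * y⌋₊, |Nd a d x - g d * N a x| with hR
  have s1 : S ^ 2 * X ≤ ∑ n ∈ Finset.Icc 1 ⌊x⌋₊,
      a n * lamF P h y (P.filter (fun p => p ∣ n)) ^ 2 := by
    rw [hX, Finset.mul_sum]
    calc _ = ∑ n ∈ (Finset.Icc 1 ⌊x⌋₊).filter (fun n => ∀ p ∈ P, ¬ p ∣ n),
          a n * lamF P h y (P.filter (fun p => p ∣ n)) ^ 2 := by
          apply Finset.sum_congr rfl
          intro n hn
          have : P.filter (fun p => p ∣ n) = ∅ := by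
            rw [Finset.filter_eq_empty_iff]; exact fun p hp => (Finset.mem_filter.1 hn).2 p hp
          rw [this, hS, lamS, lamF]
          simp [mul_comm]
      _ ≤ _ := by
          apply Finset.sum_le_sum_of_subset_of_nonneg (Finset.filter_subset _ _)
          intro n _ _
          exact mul_nonneg (ha n) (sq_nonneg _)
  have s2 : ∑ n ∈ Finset.Icc 1 ⌊x⌋₊, a n * lamF P h y (P.filter (fun p => p ∣ n)) ^ 2
      = ∑ e ∈ lamD P h y, ∑ e' ∈ lamD P h y,
        lamW P h y e * lamW P h y e' * Nd a (∏ p ∈ e ∪ e', p) x := by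
    simp only [lamF_sq hP, Finset.mul_sum]
    rw [Finset.sum_comm]
    apply Finset.sum_congr rfl
    intro e he
    rw [Finset.sum_comm]
    apply Finset.sum_congr rfl
    intro e' he'
    rw [Nd, Finset.sum_filter, Finset.mul_sum]
    apply Finset.sum_congr rfl
    intro n _
    simp only [sub_iff_dvd hP (Finset.union_subset (hsub e he) (hsub e' he')) n]
    split_ifs <;> ring
  have s3 : ∑ e ∈ lamD P h y, ∑ e' ∈ lamD P h y,
        lamW P h y e * lamW P h y e' * Nd a (∏ p ∈ e ∪ e', p) x
      = N a x * S + ∑ e ∈ lamD P h y, ∑ e' ∈ lamD P h y, lamW P h y e * lamW P h y e' *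
        (Nd a (∏ p ∈ e ∪ e', p) x - g (∏ p ∈ e ∪ e', p) * N a x) := by
    rw [hS, ← main_term hP hgh, Finset.mul_sum, ← Finset.sum_add_distrib]
    apply Finset.sum_congr rfl
    intro e he
    rw [Finset.mul_sum, ← Finset.sum_add_distrib]
    apply Finset.sum_congr rfl
    intro e' he'
    rw [mult_prod hg _ (fun p hp => hP p (Finset.union_subset (hsub e he) (hsub e' he') hp))]
    ring
  have s4 : ∑ e ∈ lamD P h y, ∑ e' ∈ lamD P h y, lamW P h y e * lamW P h y e' *
        (Nd a (∏ p ∈ e ∪ e', p) x - g (∏ p ∈ e ∪ e', p) * N a x)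
      ≤ (2 ^ k * S) ^ 2 * (16 ^ k * R) := by
    calc _ ≤ ∑ e ∈ lamD P h y, ∑ e' ∈ lamD P h y, (2 ^ k * S) ^ 2 *
        |Nd a (∏ p ∈ e ∪ e', p) x - g (∏ p ∈ e ∪ e', p) * N a x| := by
          apply Finset.sum_le_sum
          intro e he
          apply Finset.sum_le_sum
          intro e' he'
          refine (le_abs_self _).trans ?_
          rw [abs_mul, abs_mul, sq]
          have b1 := lamW_bound hP h0 h1 hk he
          have b2 := lamW_bound hP h0 h1 hk he'
          gcongr
      _ = (2 ^ k * S) ^ 2 * ∑ e ∈ lamD P h y, ∑ e' ∈ lamD P h y,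
        |Nd a (∏ p ∈ e ∪ e', p) x - g (∏ p ∈ e ∪ e', p) * N a x| := by
          simp only [Finset.mul_sum]
      _ ≤ _ := by
          apply mul_le_mul_of_nonneg_left _ (sq_nonneg _)
          exact pair_count hP hy hk (fun d => |Nd a d x - g d * N a x|) (fun d => abs_nonneg _)
  have s5 : S ^ 2 * X ≤ S ^ 2 * (N a x / S + 64 ^ k * R) := by
    have : S ^ 2 * (N a x / S + 64 ^ k * R) = N a x * S + (2 ^ k * S) ^ 2 * (16 ^ k * R) := by
      have : (64:ℝ) ^ k = (2 ^ k) ^ 2 * 16 ^ k := by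
        rw [← pow_mul, mul_comm k 2, pow_mul, ← mul_pow]; norm_num
      rw [this]
      field_simp
    rw [this]
    linarith
  exact le_of_mul_le_mul_left s5 (by positivity)

lemma markov_aux (P : Finset ℕ) (h : ℕ → ℝ) (hP : ∀ p ∈ P, Nat.Prime p)
    (h0 : ∀ p ∈ P, 0 ≤ h p) :
    ∑ D ∈ P.powerset, (∏ p ∈ D, h p) * ∑ p ∈ D, Real.log p ≤
      (∑ p ∈ P, h p * Real.log p) * ∏ p ∈ P, (1 + h p) := by
  induction P using Finset.induction_on with
  | empty => simp
  | insert q s hq ih =>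
    have ih' := ih (fun p hp => hP p (Finset.mem_insert_of_mem hp))
      (fun p hp => h0 p (Finset.mem_insert_of_mem hp))
    have hq0 := h0 q (Finset.mem_insert_self _ _)
    have hlq : 0 ≤ Real.log q := Real.log_natCast_nonneg q
    rw [Finset.sum_powerset_insert hq, Finset.sum_insert hq, Finset.prod_insert hq]
    have e1 : ∑ t ∈ s.powerset, (∏ p ∈ insert q t, h p) * ∑ p ∈ insert q t, Real.log p
        = h q * ∑ t ∈ s.powerset, (∏ p ∈ t, h p) * ∑ p ∈ t, Real.log p
          + h q * Real.log q * ∏ p ∈ s, (1 + h p) := by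
      rw [Finset.prod_one_add, Finset.mul_sum, Finset.mul_sum, ← Finset.sum_add_distrib]
      apply Finset.sum_congr rfl
      intro t ht
      have : q ∉ t := fun h => hq (Finset.mem_powerset.1 ht h)
      rw [Finset.prod_insert this, Finset.sum_insert this]
      ring
    rw [e1]
    have hV : 0 ≤ ∏ p ∈ s, (1 + h p) := Finset.prod_nonneg fun p hp => by
      have := h0 p (Finset.mem_insert_of_mem hp); linarith
    have := mul_le_mul_of_nonneg_left ih' (by linarith : 0 ≤ 1 + h q)
    have h3 : 0 ≤ h q * (h q * Real.log q * ∏ p ∈ s, (1 + h p)) := by positivity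
    nlinarith

lemma markov_sieve (P : Finset ℕ) (h : ℕ → ℝ) (hP : ∀ p ∈ P, Nat.Prime p)
    (h0 : ∀ p ∈ P, 0 ≤ h p) (y : ℝ) (hy : 1 < y)
    (hb : ∑ p ∈ P, h p * Real.log p ≤ Real.log y / 2) :
    (∏ p ∈ P, (1 + h p)) / 2 ≤ lamS P h y := by
  have hly := Real.log_pos hy
  have hV : 0 ≤ ∏ p ∈ P, (1 + h p) := Finset.prod_nonneg fun p hp => by
      have := h0 p hp; linarith
  have h1 := markov_aux P h hP h0
  have h2 : Real.log y * (∏ p ∈ P, (1 + h p) - lamS P h y) ≤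
      ∑ D ∈ P.powerset, (∏ p ∈ D, h p) * ∑ p ∈ D, Real.log p := by
    have e : ∏ p ∈ P, (1 + h p) - lamS P h y = ∑ D ∈ P.powerset.filter
        (fun D => ¬ ((∏ p ∈ D, p : ℕ) : ℝ) ≤ y), ∏ p ∈ D, h p := by
      rw [Finset.prod_one_add, lamS, lamD, ← Finset.sum_filter_add_sum_filter_not P.powerset
        (fun D => ((∏ p ∈ D, p : ℕ) : ℝ) ≤ y)]
      ring
    rw [e, Finset.mul_sum]
    calc _ ≤ ∑ D ∈ P.powerset.filter
            (fun D => ¬ ((∏ p ∈ D, p : ℕ) : ℝ) ≤ y), (∏ p ∈ D, h p) * ∑ p ∈ D, Real.log p := by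
          apply Finset.sum_le_sum
          intro D hD
          simp only [Finset.mem_filter, Finset.mem_powerset, not_le] at hD
          rw [mul_comm]
          apply mul_le_mul_of_nonneg_left _ (Finset.prod_nonneg fun p hp => h0 p (hD.1 hp))
          rw [← Real.log_prod (fun p hp => by exact_mod_cast (hP p (hD.1 hp)).ne_zero)]
          apply Real.log_le_log (by linarith)
          have := hD.2.le
          push_cast at this
          exact this
      _ ≤ _ := by
          apply Finset.sum_le_sum_of_subset_of_nonneg (Finset.filter_subset _ _)
          intro D hD _
          rw [Finset.mem_powerset] at hD
          exact mul_nonneg (Finset.prod_nonneg fun p hp => h0 p (hD hp))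
            (Finset.sum_nonneg fun p hp => Real.log_natCast_nonneg p)
  have h3 := mul_le_mul_of_nonneg_right hb hV
  have h4 : Real.log y * (∏ p ∈ P, (1 + h p) - lamS P h y) ≤
      Real.log y * ((∏ p ∈ P, (1 + h p)) / 2) := by linarith
  have := le_of_mul_le_mul_left h4 hly
  linarith

noncomputable def PP (s t : ℝ) : Finset ℕ :=
  (Finset.Icc 1 ⌊t⌋₊).filter (fun p => Nat.Prime p ∧ s < p)

lemma mem_PP {s t : ℝ} (ht : 0 ≤ t) {p : ℕ} : p ∈ PP s t ↔ p.Prime ∧ s < p ∧ (p:ℝ) ≤ t := by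
  simp only [PP, Finset.mem_filter, Finset.mem_Icc, Nat.le_floor_iff ht]
  exact ⟨fun h => ⟨h.2.1, h.2.2, h.1.2⟩, fun h => ⟨⟨h.1.one_lt.le, h.2.2⟩, h.1, h.2.1⟩⟩

lemma PP_add {s t u : ℝ} (hs : 0 ≤ s) (hst : s ≤ t) (htu : t ≤ u) (f : ℕ → ℝ) :
    ∑ p ∈ PP s u, f p = ∑ p ∈ PP s t, f p + ∑ p ∈ PP t u, f p := by
  rw [← Finset.sum_union]
  · apply Finset.sum_congr _ (fun _ _ => rfl)
    ext p
    rw [Finset.mem_union, mem_PP (by linarith), mem_PP (by linarith), mem_PP (by linarith)]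
    constructor
    · rintro ⟨h1, h2, h3⟩
      rcases le_or_gt (p:ℝ) t with h | h
      · exact Or.inl ⟨h1, h2, h⟩
      · exact Or.inr ⟨h1, h, h3⟩
    · rintro (⟨h1, h2, h3⟩ | ⟨h1, h2, h3⟩)
      · exact ⟨h1, h2, by linarith⟩
      · exact ⟨h1, by linarith, h3⟩
  · rw [Finset.disjoint_left]
    intro p h1 h2
    rw [mem_PP (by linarith)] at h1 h2
    linarith [h1.2.2, h2.2.1]

lemma PP_log {g : ℕ → ℝ} {M : ℝ} (hM : ∀ x : ℝ, 2 ≤ x →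
      |(∑ p ∈ (Finset.Icc 1 ⌊x⌋₊).filter Nat.Prime, g p * Real.log p) - Real.log x| ≤ M)
    {s t : ℝ} (hs : 2 ≤ s) (hst : s ≤ t) :
    |∑ p ∈ PP s t, g p * Real.log p - (Real.log t - Real.log s)| ≤ 2 * M := by
  have e : ∀ u : ℝ, (Finset.Icc 1 ⌊u⌋₊).filter Nat.Prime = PP 0 u := by
    intro u
    ext p
    simp only [PP, Finset.mem_filter]
    exact ⟨fun h => ⟨h.1, h.2, by exact_mod_cast h.2.pos⟩, fun h => ⟨h.1, h.2.1⟩⟩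
  have h1 := hM s hs
  have h2 := hM t (by linarith)
  rw [e] at h1 h2
  rw [PP_add le_rfl (by linarith) hst] at h2
  rw [abs_le] at *
  constructor <;> linarith [h1.1, h1.2, h2.1, h2.2]

lemma PP_block {g : ℕ → ℝ} (hg0 : ∀ d : ℕ, 1 ≤ d → g d ∈ Set.Icc (0:ℝ) 1)
    {M : ℝ} (hM : ∀ x : ℝ, 2 ≤ x →
      |(∑ p ∈ (Finset.Icc 1 ⌊x⌋₊).filter Nat.Prime, g p * Real.log p) - Real.log x| ≤ M)
    {s t : ℝ} (hs : 2 ≤ s) (hst : s ≤ t) :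
    (Real.log t - Real.log s - 2 * M) / Real.log t ≤ ∑ p ∈ PP s t, g p := by
  have hl : 0 < Real.log t := Real.log_pos (by linarith)
  rw [div_le_iff₀ hl, Finset.sum_mul]
  have h1 := (abs_le.1 (PP_log hM hs hst)).1
  have h2 : ∑ p ∈ PP s t, g p * Real.log p ≤ ∑ p ∈ PP s t, g p * Real.log t := by
    apply Finset.sum_le_sum
    intro p hp
    rw [mem_PP (by linarith)] at hp
    apply mul_le_mul_of_nonneg_left _ (hg0 p hp.1.one_lt.le).1
    exact Real.log_le_log (by exact_mod_cast hp.1.pos) hp.2.2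
  linarith

lemma PP_harm {g : ℕ → ℝ} (hg0 : ∀ d : ℕ, 1 ≤ d → g d ∈ Set.Icc (0:ℝ) 1)
    {M : ℝ} (hM0 : 0 ≤ M) (hM : ∀ x : ℝ, 2 ≤ x →
      |(∑ p ∈ (Finset.Icc 1 ⌊x⌋₊).filter Nat.Prime, g p * Real.log p) - Real.log x| ≤ M)
    {x ε : ℝ} (hx : 2 ≤ x) (hε : 0 < ε) (hxε : 2 ≤ x ^ ε) (J : ℕ) :
    ((harmonic (J + 1) : ℚ) : ℝ) - 1 - J * (2 * M / (ε * Real.log x)) ≤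
      ∑ p ∈ PP (x ^ ε) (x ^ (((J + 1 : ℕ) : ℝ) * ε)), g p := by
  have hl : 0 < Real.log x := Real.log_pos (by linarith)
  induction J with
  | zero =>
    simp only [zero_add, Nat.cast_one, one_mul, Nat.cast_zero, zero_mul, sub_zero]
    have : ((harmonic 1 : ℚ) : ℝ) = 1 := by simp [harmonic]
    rw [this, sub_self]
    apply Finset.sum_nonneg
    intro p hp
    rw [mem_PP (by positivity)] at hp
    exact (hg0 p hp.1.one_lt.le).1
  | succ J ih =>
    have m1 : x ^ ε ≤ x ^ (((J + 1 : ℕ) : ℝ) * ε) := by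
      apply Real.rpow_le_rpow_of_exponent_le (by linarith)
      push_cast
      nlinarith [(Nat.cast_nonneg J : (0:ℝ) ≤ J)]
    have m2 : x ^ (((J + 1 : ℕ) : ℝ) * ε) ≤ x ^ (((J + 1 + 1 : ℕ) : ℝ) * ε) := by
      apply Real.rpow_le_rpow_of_exponent_le (by linarith)
      push_cast
      nlinarith [(Nat.cast_nonneg J : (0:ℝ) ≤ J)]
    rw [PP_add (by positivity) m1 m2]
    have hb := PP_block hg0 hM (hxε.trans m1) m2
    rw [Real.log_rpow (by linarith), Real.log_rpow (by linarith)] at hb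
    have hh : ((harmonic (J + 1 + 1) : ℚ) : ℝ) = ((harmonic (J + 1) : ℚ) : ℝ) + ((J:ℝ) + 2)⁻¹ := by
      rw [harmonic_succ]; push_cast; ring
    have e1 : (((J + 1 + 1 : ℕ) : ℝ) * ε * Real.log x - ((J + 1 : ℕ) : ℝ) * ε * Real.log x - 2 * M)
        / (((J + 1 + 1 : ℕ) : ℝ) * ε * Real.log x)
        = ((J:ℝ) + 2)⁻¹ - 2 * M / (ε * Real.log x) * ((J:ℝ) + 2)⁻¹ := by
      push_cast
      have : (J:ℝ) + 1 + 1 = J + 2 := by ring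
      rw [this]
      have : (J:ℝ) + 2 ≠ 0 := by positivity
      field_simp
      ring
    rw [e1] at hb
    have e2 : 2 * M / (ε * Real.log x) * ((J:ℝ) + 2)⁻¹ ≤ 2 * M / (ε * Real.log x) := by
      apply mul_le_of_le_one_right (by positivity)
      apply inv_le_one_of_one_le₀
      linarith [(Nat.cast_nonneg J : (0:ℝ) ≤ J)]
    rw [hh]
    push_cast at *
    linarith

lemma foldr_max (l : List ℕ) : l.foldr max 1 = 1 ∨ l.foldr max 1 ∈ l := by
  induction l with
  | nil => simp
  | cons b l ih =>
    simp only [List.foldr_cons, List.mem_cons]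
    rcases max_choice b (l.foldr max 1) with h | h
    · right; left; exact h
    · rw [h]; tauto

lemma no_mid {x ε : ℝ} (hx : 2 ≤ x) (hε0 : 0 < ε) (hε : ε ≤ 1 / 4) {n : ℕ}
    (hn1 : x ^ (1 / 2 : ℝ) < n) (hn2 : (n:ℝ) ≤ x) (hn3 : (n:ℝ) ^ (1 - ε) ≤ (Pplus n : ℝ))
    {q : ℕ} (hq : q.Prime) (hq1 : x ^ ε < q) (hq2 : (q:ℝ) ≤ x ^ (1 / 16 : ℝ)) : ¬ q ∣ n := by
  intro hqn
  have hx1 : (1:ℝ) < x := by linarith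
  have hn0 : (0:ℝ) < n := lt_trans (by positivity) hn1
  have hbig : x ^ (3 / 8 : ℝ) ≤ Pplus n := by
    refine le_trans ?_ hn3
    calc x ^ (3 / 8 : ℝ) ≤ x ^ ((1 / 2 : ℝ) * (1 - ε)) :=
          Real.rpow_le_rpow_of_exponent_le hx1.le (by linarith)
      _ = (x ^ (1 / 2 : ℝ)) ^ (1 - ε) := Real.rpow_mul (by linarith) _ _
      _ ≤ _ := Real.rpow_le_rpow (by positivity) hn1.le (by linarith)
  have hlt : x ^ (1 / 16 : ℝ) < x ^ (3 / 8 : ℝ) := Real.rpow_lt_rpow_of_exponent_lt hx1 (by norm_num)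
  have hmem : Pplus n ∈ n.primeFactorsList := by
    rcases foldr_max n.primeFactorsList with h | h
    · exfalso
      have h' : Pplus n = 1 := h
      rw [h'] at hbig
      have : (1:ℝ) < x ^ (3 / 8 : ℝ) := Real.one_lt_rpow hx1 (by norm_num)
      push_cast at hbig
      linarith
    · exact h
  have hp := Nat.prime_of_mem_primeFactorsList hmem
  obtain ⟨m, hm⟩ := Nat.dvd_of_mem_primeFactorsList hmem
  have hne : q ≠ Pplus n := by
    intro h
    rw [← h] at hbig
    linarith
  have hqm : q ∣ m := by
    rw [hm] at hqn
    rcases (Nat.Prime.dvd_mul hq).1 hqn with h | h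
    · exact absurd ((Nat.prime_dvd_prime_iff_eq hq hp).1 h) hne
    · exact h
  have hm0 : 0 < m := by
    rcases Nat.eq_zero_or_pos m with h | h
    · rw [h, mul_zero] at hm; rw [hm] at hn0; simp at hn0
    · exact h
  have hqle : (q:ℝ) ≤ m := by exact_mod_cast Nat.le_of_dvd hm0 hqm
  have hmn : (n:ℝ) = Pplus n * m := by exact_mod_cast hm
  have hnn : (n:ℝ) = (n:ℝ) ^ (1 - ε) * (n:ℝ) ^ ε := by
    rw [← Real.rpow_add hn0]; simp
  have hmle : (m:ℝ) ≤ (n:ℝ) ^ ε := by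
    have h1 : (n:ℝ) ^ (1 - ε) * m ≤ (n:ℝ) ^ (1 - ε) * (n:ℝ) ^ ε := by
      rw [← hnn]
      nth_rewrite 2 [hmn]
      gcongr
    exact le_of_mul_le_mul_left h1 (by positivity)
  have : (n:ℝ) ^ ε ≤ x ^ ε := Real.rpow_le_rpow hn0.le hn2 hε0.le
  linarith

lemma N_nonneg (a : ℕ → ℝ) (ha : ∀ n, 0 ≤ a n) (x : ℝ) : 0 ≤ N a x :=
  Finset.sum_nonneg fun n _ => ha n

lemma split_bound (a : ℕ → ℝ) (ha : ∀ n, 0 ≤ a n) {x ε c : ℝ} (hx : 2 ≤ x) (hε0 : 0 < ε)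
    (hε : ε ≤ 1 / 4) (hc : c ≤ 1 / 16) :
    ∑ n ∈ (Finset.Icc 1 ⌊x⌋₊).filter (fun n : ℕ => (n:ℝ) ^ (1 - ε) ≤ (Pplus n : ℝ)), a n
      ≤ N a (x ^ (1 / 2 : ℝ)) + ∑ n ∈ (Finset.Icc 1 ⌊x⌋₊).filter
        (fun n => ∀ p ∈ PP (x ^ ε) (x ^ c), ¬ p ∣ n), a n := by
  rw [N]
  calc _ ≤ ∑ n ∈ Finset.Icc 1 ⌊x ^ (1 / 2 : ℝ)⌋₊ ∪ (Finset.Icc 1 ⌊x⌋₊).filter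
            (fun n => ∀ p ∈ PP (x ^ ε) (x ^ c), ¬ p ∣ n), a n := by
        apply Finset.sum_le_sum_of_subset_of_nonneg
        · intro n hn
          simp only [Finset.mem_filter, Finset.mem_Icc] at hn
          rw [Finset.mem_union]
          rcases le_or_gt (n:ℝ) (x ^ (1 / 2 : ℝ)) with h | h
          · left
            rw [Finset.mem_Icc]
            exact ⟨hn.1.1, Nat.le_floor h⟩
          · right
            simp only [Finset.mem_filter, Finset.mem_Icc]
            refine ⟨hn.1, fun p hp => ?_⟩
            rw [mem_PP (by positivity)] at hp
            apply no_mid hx hε0 hε h ((Nat.le_floor_iff (by linarith)).1 hn.1.2) hn.2 hp.1 hp.2.1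
            exact hp.2.2.trans (Real.rpow_le_rpow_of_exponent_le (by linarith) hc)
        · intro n _ _; exact ha n
    _ ≤ _ := by
        have := Finset.sum_union_inter (s₁ := Finset.Icc 1 ⌊x ^ (1 / 2 : ℝ)⌋₊)
          (s₂ := (Finset.Icc 1 ⌊x⌋₊).filter
            (fun n => ∀ p ∈ PP (x ^ ε) (x ^ c), ¬ p ∣ n)) (f := a)
        rw [← this]
        exact le_add_of_nonneg_right (Finset.sum_nonneg fun n _ => ha n)

lemma small_case (a : ℕ → ℝ) (ha : ∀ n, 0 ≤ a n)
    (ϑ : ℝ) (hϑ0 : 0 < ϑ) (hϑ1 : ϑ ≤ 1) (g : ℕ → ℝ)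
    (hreg : Regular a) (hlev : HasLevel a ϑ g) (c : ℝ) (hc : c = ϑ / 2)
    (ε : ℝ) (hε0 : 0 < ε) (hε1 : ε ≤ 1 / 4) (hε2 : ε ≤ c / 16) :
    ∀ᶠ x : ℝ in atTop,
      ∑ n ∈ (Finset.Icc 1 ⌊x⌋₊).filter (fun n : ℕ => (n:ℝ) ^ (1 - ε) ≤ (Pplus n : ℝ)), a n
        ≤ (32 * Real.exp 2 / c + 2) * ε * N a x := by
  obtain ⟨hmul, hg0, ⟨M, hM⟩, ⟨C, hC1, K, hK⟩, hl⟩ := hlev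
  have hM0 : 0 ≤ M := (abs_nonneg _).trans (hM 2 le_rfl)
  have hc0 : 0 < c := by rw [hc]; linarith
  have hc1 : c ≤ 1 / 2 := by rw [hc]; linarith
  obtain ⟨KR, hKR⟩ := hl c hc0 (by rw [hc]; linarith) 1 one_pos
  obtain ⟨J, hJ⟩ : ∃ J : ℕ, ⌊c / (16 * ε)⌋₊ = J + 1 := by
    apply Nat.exists_eq_succ_of_ne_zero
    have : 1 ≤ ⌊c / (16 * ε)⌋₊ := by
      apply Nat.le_floor
      rw [Nat.cast_one, le_div_iff₀ (by positivity)]; linarith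
    omega
  have hJ1 : ((J + 1 : ℕ) : ℝ) * ε ≤ c / 16 := by
    have : ((J + 1 : ℕ) : ℝ) ≤ c / (16 * ε) := by
      rw [← hJ]; exact Nat.floor_le (by positivity)
    rw [le_div_iff₀ (by positivity)] at this
    linarith
  have hJ2 : c / (16 * ε) ≤ ((J + 1 + 1 : ℕ) : ℝ) := by
    have := Nat.lt_floor_add_one (c / (16 * ε))
    rw [hJ] at this
    push_cast at this ⊢
    exact this.le
  set k := ⌈1 / ε⌉₊ with hkdef
  have hlit := (hreg (1 / 2) (by norm_num) (by norm_num)).def hε0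
  have t1 := (tendsto_rpow_atTop hε0).eventually (eventually_ge_atTop (max 2 (2 * (K * C))))
  have t2 := Real.tendsto_log_atTop.eventually (eventually_ge_atTop (32 * M / c))
  have t3 := Real.tendsto_log_atTop.eventually (eventually_ge_atTop (J * (2 * M / ε)))
  have t4 := Real.tendsto_log_atTop.eventually (eventually_ge_atTop (64 ^ k * KR / ε))
  filter_upwards [hlit, t1, t2, t3, t4, eventually_ge_atTop 2] with x hlit t1 t2 t3 t4 hx
  have hxε : 2 ≤ x ^ ε := (le_max_left _ _).trans t1
  have hxK : 2 * (K * C) ≤ x ^ ε := (le_max_right _ _).trans t1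
  have hx1 : 1 < x := by linarith
  have hL : 0 < Real.log x := Real.log_pos hx1
  have hNn := N_nonneg a ha x
  rw [Real.norm_of_nonneg (N_nonneg a ha _), Real.norm_of_nonneg hNn] at hlit
  set P := PP (x ^ ε) (x ^ (((J + 1 : ℕ) : ℝ) * ε)) with hPdef
  have memP : ∀ p ∈ P, p.Prime ∧ x ^ ε < p ∧ (p:ℝ) ≤ x ^ (((J + 1 : ℕ) : ℝ) * ε) :=
    fun p hp => (mem_PP (by positivity)).1 hp
  have hgP : ∀ p ∈ P, 0 ≤ g p ∧ g p ≤ 1 / 2 := by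
    intro p hp
    obtain ⟨hp1, hp2, _⟩ := memP p hp
    refine ⟨(hg0 p hp1.one_lt.le).1, ?_⟩
    have := hK p hp1.one_lt.le
    have hb : bigOmega p = 1 := by simp [bigOmega, Nat.primeFactorsList_prime hp1]
    rw [hb, pow_one] at this
    refine this.trans ?_
    rw [div_le_iff₀ (by linarith)]
    linarith
  set h : ℕ → ℝ := fun p => g p / (1 - g p) with hh
  have hgh : ∀ p ∈ P, g p * (1 + h p) = h p := by
    intro p hp
    have : 1 - g p ≠ 0 := by have := hgP p hp; linarith
    simp only [hh]; field_simp; ring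
  have h0 : ∀ p ∈ P, 0 ≤ h p := by
    intro p hp
    have := hgP p hp
    exact div_nonneg this.1 (by linarith)
  have h1 : ∀ p ∈ P, h p ≤ 1 := by
    intro p hp
    have := hgP p hp
    simp only [hh]
    rw [div_le_iff₀ (by linarith)]; linarith
  have h2 : ∀ p ∈ P, h p ≤ 2 * g p := by
    intro p hp
    have := hgP p hp
    simp only [hh]
    rw [div_le_iff₀ (by linarith)]; nlinarith
  have hexp : ∀ p ∈ P, Real.exp (g p) ≤ 1 + h p := by
    intro p hp
    have hgp := hgP p hp
    have e1 : 1 + h p = (1 - g p)⁻¹ := by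
      have : 1 - g p ≠ 0 := by linarith
      simp only [hh]; field_simp; ring
    rw [e1, le_inv_comm₀ (Real.exp_pos _) (by linarith), ← Real.exp_neg]
    have := Real.add_one_le_exp (-g p)
    linarith
  set y := x ^ (c / 2) with hy
  have hy1 : 1 < y := Real.one_lt_rpow hx1 (by linarith)
  have hyy : y * y = x ^ c := by
    rw [hy, ← Real.rpow_add (by linarith)]; congr 1; ring
  have hk : ∀ D ∈ lamD P h y, D.card ≤ k := by
    intro D hD
    simp only [lamD, Finset.mem_filter, Finset.mem_powerset] at hD
    have b1 : (x ^ ε) ^ D.card ≤ ((∏ p ∈ D, p : ℕ) : ℝ) := by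
      push_cast
      rw [← Finset.prod_const]
      apply Finset.prod_le_prod
      · intros; positivity
      · intro p hp; exact (memP p (hD.1 hp)).2.1.le
    have b2 : x ^ (ε * D.card) ≤ x ^ (1:ℝ) := by
      rw [Real.rpow_mul (by linarith), Real.rpow_natCast]
      refine b1.trans (hD.2.trans ?_)
      exact Real.rpow_le_rpow_of_exponent_le hx1.le (by linarith)
    rw [Real.rpow_le_rpow_left_iff hx1] at b2
    have b3 : (D.card : ℝ) ≤ 1 / ε := by
      rw [le_div_iff₀ hε0]; linarith
    exact_mod_cast b3.trans (Nat.le_ceil _)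
  have hPp : ∀ p ∈ P, Nat.Prime p := fun p hp => (memP p hp).1
  have hst : x ^ ε ≤ x ^ (((J + 1 : ℕ) : ℝ) * ε) := by
    apply Real.rpow_le_rpow_of_exponent_le hx1.le
    push_cast
    nlinarith [(Nat.cast_nonneg J : (0:ℝ) ≤ J)]
  have hsum : ∑ p ∈ P, h p * Real.log p ≤ Real.log y / 2 := by
    have e1 : ∑ p ∈ P, h p * Real.log p ≤ 2 * ∑ p ∈ P, g p * Real.log p := by
      rw [Finset.mul_sum]
      apply Finset.sum_le_sum
      intro p hp
      rw [← mul_assoc]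
      exact mul_le_mul_of_nonneg_right (h2 p hp) (Real.log_natCast_nonneg p)
    have e2 := (abs_le.1 (PP_log hM hxε hst)).2
    rw [Real.log_rpow (by linarith), Real.log_rpow (by linarith)] at e2
    have e3 : ((J + 1 : ℕ) : ℝ) * ε * Real.log x ≤ c / 16 * Real.log x :=
      mul_le_mul_of_nonneg_right hJ1 hL.le
    have e4 : 0 ≤ ε * Real.log x := by positivity
    rw [div_le_iff₀ hc0] at t2
    rw [hy, Real.log_rpow (by linarith)]
    linarith
  have hS1 := markov_sieve P h hPp h0 y hy1 hsum
  have hV : c / (16 * ε) / Real.exp 2 ≤ ∏ p ∈ P, (1 + h p) := by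
    have e1 : Real.exp (∑ p ∈ P, g p) ≤ ∏ p ∈ P, (1 + h p) := by
      rw [Real.exp_sum]
      exact Finset.prod_le_prod (fun p _ => (Real.exp_pos _).le) hexp
    refine le_trans ?_ e1
    have e2 := PP_harm hg0 hM0 hM hx hε0 hxε J
    have e3 := log_add_one_le_harmonic (J + 1)
    have e4 : J * (2 * M / (ε * Real.log x)) ≤ 1 := by
      have : J * (2 * M / (ε * Real.log x)) = J * (2 * M / ε) / Real.log x := by
        field_simp
      rw [this, div_le_one hL]
      exact t3
    have e5 : Real.log ((J + 1 + 1 : ℕ) : ℝ) - 2 ≤ ∑ p ∈ P, g p := by linarith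
    calc c / (16 * ε) / Real.exp 2 ≤ ((J + 1 + 1 : ℕ) : ℝ) / Real.exp 2 := by gcongr
      _ = Real.exp (Real.log ((J + 1 + 1 : ℕ) : ℝ) - 2) := by
          rw [Real.exp_sub, Real.exp_log (by positivity)]
      _ ≤ _ := Real.exp_le_exp.2 e5
  have hS : c / (32 * ε * Real.exp 2) ≤ lamS P h y := by
    refine le_trans ?_ hS1
    refine le_trans (le_of_eq ?_) (div_le_div_of_nonneg_right hV (by norm_num : (0:ℝ) ≤ 2))
    field_simp
    norm_num
  have hmain := sieve_bound a ha x hmul hPp hy1.le h0 h1 hgh hk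
  have hNS : N a x / lamS P h y ≤ 32 * Real.exp 2 / c * ε * N a x := by
    calc N a x / lamS P h y ≤ N a x / (c / (32 * ε * Real.exp 2)) := by gcongr
      _ = _ := by field_simp
  have hR : 64 ^ k * ∑ d ∈ Finset.Icc 1 ⌊y * y⌋₊, |Nd a d x - g d * N a x| ≤ ε * N a x := by
    rw [hyy]
    have e1 := hKR x hx
    rw [Real.rpow_one] at e1
    calc _ ≤ 64 ^ k * (KR * N a x / Real.log x) := by gcongr
      _ = (64 ^ k * KR) / Real.log x * N a x := by ring
      _ ≤ ε * N a x := by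
          apply mul_le_mul_of_nonneg_right _ hNn
          rw [div_le_iff₀ hε0] at t4
          rw [div_le_iff₀ hL]; linarith
  have hsp := split_bound a ha hx hε0 hε1 (c := ((J + 1 : ℕ) : ℝ) * ε) (by linarith)
  calc _ ≤ _ := hsp
    _ ≤ ε * N a x + (32 * Real.exp 2 / c * ε * N a x + ε * N a x) := by
        apply add_le_add hlit
        exact hmain.trans (add_le_add hNS hR)
    _ = _ := by ring

/-- for a regular, locally uniform sequence of positive level of
distribution, the proportion of `n ≤ x` with `P⁺(n) ≥ n^{1-ε}` is at most `K ε`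
in the limsup, for a constant `K` depending only on the sequence. -/
theorem largest_prime_factor_upper_bound (a : ℕ → ℝ) (ha : ∀ n, 0 ≤ a n)
    (ϑ : ℝ) (hϑ0 : 0 < ϑ) (hϑ1 : ϑ ≤ 1) (g : ℕ → ℝ)
    (hreg : Regular a) (hlev : HasLevel a ϑ g) (hloc : LocallyUniform a) :
    ∃ K : ℝ, 0 < K ∧ ∀ ε : ℝ, 0 < ε →
      Filter.limsup (fun x : ℝ => (1 / N a x) *
          ∑ n ∈ (Finset.Icc 1 ⌊x⌋₊).filter (fun n : ℕ => (n:ℝ) ^ (1 - ε) ≤ (Pplus n : ℝ)), a n)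
        atTop ≤ K * ε := by
  set c := ϑ / 2 with hc
  have hc0 : 0 < c := by rw [hc]; linarith
  have he := Real.exp_pos 2
  refine ⟨4 + 16 / c + (32 * Real.exp 2 / c + 2), by positivity, fun ε hε => ?_⟩
  have hev : ∀ᶠ x : ℝ in atTop,
      ∑ n ∈ (Finset.Icc 1 ⌊x⌋₊).filter (fun n : ℕ => (n:ℝ) ^ (1 - ε) ≤ (Pplus n : ℝ)), a n
        ≤ (4 + 16 / c + (32 * Real.exp 2 / c + 2)) * ε * N a x := by
    by_cases hsm : ε ≤ 1 / 4 ∧ ε ≤ c / 16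
    · filter_upwards [small_case a ha ϑ hϑ0 hϑ1 g hreg hlev c hc ε hε hsm.1 hsm.2] with x hx
      refine hx.trans ?_
      apply mul_le_mul_of_nonneg_right _ (N_nonneg a ha x)
      apply mul_le_mul_of_nonneg_right _ hε.le
      have : 0 < 16 / c := by positivity
      linarith
    · refine Eventually.of_forall fun x => ?_
      have h1 : 1 ≤ (4 + 16 / c + (32 * Real.exp 2 / c + 2)) * ε := by
        have p1 : 0 < 16 / c * ε := by positivity
        have p2 : 0 < (32 * Real.exp 2 / c + 2) * ε := by positivity
        rcases not_and_or.1 hsm with h | h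
        · push Not at h
          linarith
        · push Not at h
          have : 1 ≤ 16 / c * ε := by
            rw [div_mul_eq_mul_div, le_div_iff₀ hc0]; linarith
          linarith
      calc _ ≤ N a x := by
            rw [N]
            exact Finset.sum_le_sum_of_subset_of_nonneg (Finset.filter_subset _ _)
              (fun n _ _ => ha n)
        _ ≤ _ := le_mul_of_one_le_left (N_nonneg a ha x) h1
  apply Filter.limsup_le_of_le
  · apply Filter.IsBoundedUnder.isCoboundedUnder_le
    refine Filter.isBoundedUnder_of_eventually_ge (a := 0) (Eventually.of_forall fun x => ?_)
    exact mul_nonneg (one_div_nonneg.2 (N_nonneg a ha x)) (Finset.sum_nonneg fun n _ => ha n)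
  · filter_upwards [hev] with x hx
    rcases (N_nonneg a ha x).eq_or_lt with h | h
    · rw [← h]; simp only [div_zero, zero_mul]; positivity
    · rw [one_div, inv_mul_le_iff₀ h]; linarith
end

section
/- There is an absolute constant K > 0 such that for every ε > 0: limsup_{x→∞} #{ p ≤ x : p prime and P^+(p−1) ≥ p^{1−ε} } / π(x) ≤ K·ε. -/
open Finset Filter Real

open scoped Classical

lemma crt_sum {A B : ℕ} (hA : 0 < A) (hB : 0 < B) (h : A.Coprime B) (f g : ℕ → ℝ)
    (hf : ∀ n, f (n % A) = f n) (hg : ∀ n, g (n % B) = g n) :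
    ∑ n ∈ range (A * B), f n * g n = (∑ n ∈ range A, f n) * (∑ n ∈ range B, g n) := by
  rw [sum_mul_sum, ← sum_product']
  refine sum_bij (fun n _ => (n % A, n % B)) ?_ ?_ ?_ ?_
  · intro n _
    simp [Nat.mod_lt _ hA, Nat.mod_lt _ hB]
  · intro a ha b hb hab
    simp only [Prod.mk.injEq] at hab
    have h1 : a ≡ b [MOD A * B] := (Nat.modEq_and_modEq_iff_modEq_mul h).1 ⟨hab.1, hab.2⟩
    exact Nat.ModEq.eq_of_lt_of_lt h1 (mem_range.1 ha) (mem_range.1 hb)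
  · rintro ⟨a, b⟩ hab
    simp only [mem_product, mem_range] at hab
    refine ⟨Nat.chineseRemainder h a b, ?_, ?_⟩
    · exact mem_range.2 (Nat.chineseRemainder_lt_mul h a b hA.ne' hB.ne')
    · have h1 := (Nat.chineseRemainder h a b).2.1
      have h2 := (Nat.chineseRemainder h a b).2.2
      ext
      · exact Eq.trans h1 (Nat.mod_eq_of_lt hab.1)
      · exact Eq.trans h2 (Nat.mod_eq_of_lt hab.2)
  · intro n _
    simp [hf, hg]

lemma prod_mod_periodic (T : Finset ℕ) (φ : ℕ → ℕ → ℝ) (hφ : ∀ p ∈ T, ∀ n, φ p (n % p) = φ p n)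
    (n : ℕ) : ∏ p ∈ T, φ p (n % ∏ q ∈ T, q) = ∏ p ∈ T, φ p n := by
  refine prod_congr rfl fun p hp => ?_
  rw [← hφ p hp, Nat.mod_mod_of_dvd _ (dvd_prod_of_mem _ hp), hφ p hp]

lemma mean_prod (T : Finset ℕ) (hT : ∀ p ∈ T, p.Prime) (φ : ℕ → ℕ → ℝ)
    (hφ : ∀ p ∈ T, ∀ n, φ p (n % p) = φ p n) :
    ∑ n ∈ range (∏ p ∈ T, p), ∏ p ∈ T, φ p n = ∏ p ∈ T, ∑ n ∈ range p, φ p n := by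
  induction T using Finset.induction_on with
  | empty => simp
  | insert p T hp ih =>
    rw [prod_insert hp, prod_insert hp]
    have hT' : ∀ q ∈ T, q.Prime := fun q hq => hT q (mem_insert_of_mem hq)
    have hφ' : ∀ q ∈ T, ∀ n, φ q (n % q) = φ q n := fun q hq => hφ q (mem_insert_of_mem hq)
    rw [← ih hT' hφ']
    simp_rw [prod_insert hp]
    apply crt_sum (hT p (mem_insert_self _ _)).pos (prod_pos fun q hq => (hT' q hq).pos)
    · apply Nat.Coprime.prod_right
      intro q hq
      exact (Nat.coprime_primes (hT p (mem_insert_self _ _)) (hT' q hq)).2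
        (by rintro rfl; exact hp hq)
    · exact hφ p (mem_insert_self _ _)
    · exact prod_mod_periodic T φ hφ'

lemma periodic_sum_mul (M : ℕ) (f : ℕ → ℝ) (hf : ∀ n, f (n % M) = f n) (q r : ℕ) :
    ∑ n ∈ range (q * M + r), f n = q * ∑ n ∈ range M, f n + ∑ n ∈ range r, f n := by
  have hf' : ∀ q n, f (q * M + n) = f n := by
    intro q n
    rw [← hf, ← hf n]; congr 1; simp [Nat.add_mod]
  have h1 : ∀ q, ∑ n ∈ range (q * M), f n = q * ∑ n ∈ range M, f n := by
    intro q
    induction q with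
    | zero => simp
    | succ q ih =>
      rw [add_mul, one_mul, sum_range_add, ih]
      simp_rw [hf']
      push_cast; ring
  rw [sum_range_add, h1]
  simp_rw [hf']

lemma periodic_sum_err (M : ℕ) (hM : 0 < M) (f : ℕ → ℝ) (hf : ∀ n, f (n % M) = f n) (C : ℝ)
    (hC : ∀ n, |f n| ≤ C) (K : ℕ) :
    |∑ n ∈ range K, f n - (K : ℝ) / M * ∑ n ∈ range M, f n| ≤ 2 * M * C := by
  have hC0 : 0 ≤ C := (abs_nonneg _).trans (hC 0)
  have hb : ∀ r, |∑ n ∈ range r, f n| ≤ r * C := by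
    intro r
    refine (abs_sum_le_sum_abs _ _).trans ((sum_le_sum fun i _ => hC i).trans ?_)
    simp
  have hK : K = K / M * M + K % M := (Nat.div_add_mod' K M).symm
  have hM' : (0:ℝ) < M := by exact_mod_cast hM
  have hr : ((K % M : ℕ) : ℝ) ≤ M := by exact_mod_cast (Nat.mod_lt K hM).le
  have hKr : (K : ℝ) = (K / M : ℕ) * M + (K % M : ℕ) := by exact_mod_cast hK
  set q := K / M
  set r := K % M
  have e : ∑ n ∈ range K, f n - (K : ℝ) / M * ∑ n ∈ range M, f n
      = ∑ n ∈ range r, f n - (r:ℝ) / M * ∑ n ∈ range M, f n := by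
    rw [hKr, hK, periodic_sum_mul M f hf]
    field_simp
    ring
  rw [e]
  refine (abs_sub _ _).trans ?_
  rw [abs_mul, abs_of_nonneg (by positivity : (0:ℝ) ≤ (r:ℝ) / M)]
  have h1 := hb r
  have h2 : (r:ℝ) / M * |∑ n ∈ range M, f n| ≤ (r:ℝ) / M * (M * C) := by
    gcongr; exact hb M
  have h3 : (r:ℝ) / M * (M * C) = r * C := by field_simp
  have h4 : r * C ≤ M * C := by gcongr
  linarith


noncomputable def sg (ρ : ℕ → ℕ) (p : ℕ) : ℝ := (ρ p : ℝ) / ((p : ℝ) - ρ p)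

noncomputable def sψ (ρ : ℕ → ℕ) (bad : ℕ → ℕ → Prop) (p n : ℕ) : ℝ :=
  if bad p n then -(((p : ℝ) - ρ p) / ρ p) else 1

noncomputable def sG (ρ : ℕ → ℕ) (l : ℕ) : ℝ := ∏ p ∈ l.primeFactors, sg ρ p

noncomputable def sS (ρ : ℕ → ℕ) (z : ℕ) : ℝ :=
  ∑ l ∈ (Icc 1 z).filter Squarefree, sG ρ l

structure SieveData (ρ : ℕ → ℕ) (bad : ℕ → ℕ → Prop) : Prop where
  pos : ∀ p, p.Prime → 0 < ρ p
  lt : ∀ p, p.Prime → ρ p < p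
  per : ∀ p n, bad p (n % p) ↔ bad p n
  card : ∀ p, p.Prime → ((range p).filter (bad p)).card = ρ p

namespace SieveData

variable {ρ : ℕ → ℕ} {bad : ℕ → ℕ → Prop}

lemma gpos (H : SieveData ρ bad) {p : ℕ} (hp : p.Prime) : 0 < sg ρ p := by
  have h1 : (0:ℝ) < ρ p := by exact_mod_cast H.pos p hp
  have h2 : (ρ p : ℝ) < p := by exact_mod_cast H.lt p hp
  unfold sg
  exact div_pos h1 (by linarith)

lemma Gpos (H : SieveData ρ bad) (l : ℕ) : 0 < sG ρ l :=
  prod_pos fun _ hp => H.gpos (Nat.prime_of_mem_primeFactors hp)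

lemma ψper (H : SieveData ρ bad) (p n : ℕ) : sψ ρ bad p (n % p) = sψ ρ bad p n := by
  unfold sψ
  simp only [H.per]

lemma ψabs (H : SieveData ρ bad) {p : ℕ} (hp : p.Prime) (n : ℕ) : |sψ ρ bad p n| ≤ p := by
  have h1 : (1:ℝ) ≤ ρ p := by exact_mod_cast H.pos p hp
  have h2 : (ρ p : ℝ) < p := by exact_mod_cast H.lt p hp
  unfold sψ
  split_ifs
  · rw [abs_neg, abs_of_nonneg (div_nonneg (by linarith) (by linarith)),
      div_le_iff₀ (by linarith)]
    nlinarith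
  · rw [abs_one]; linarith

lemma ψmean (H : SieveData ρ bad) {p : ℕ} (hp : p.Prime) :
    ∑ n ∈ range p, sψ ρ bad p n = 0 := by
  have h1 : (1:ℝ) ≤ ρ p := by exact_mod_cast H.pos p hp
  unfold sψ
  rw [sum_ite, sum_const, sum_const, nsmul_eq_mul, nsmul_eq_mul, H.card p hp]
  have h3 := card_filter_add_card_filter_not (s := range p) (bad p)
  rw [H.card p hp, card_range] at h3
  have h4 : (ρ p : ℝ) + ((range p).filter (fun n => ¬ bad p n)).card = p := by exact_mod_cast h3
  have : ((range p).filter (fun n => ¬ bad p n)).card = (p : ℝ) - ρ p := by linarith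
  rw [this]
  field_simp
  ring

lemma ψmeansq (H : SieveData ρ bad) {p : ℕ} (hp : p.Prime) :
    ∑ n ∈ range p, sψ ρ bad p n * sψ ρ bad p n = p / sg ρ p := by
  have h1 : (1:ℝ) ≤ ρ p := by exact_mod_cast H.pos p hp
  have h2 : (ρ p : ℝ) < p := by exact_mod_cast H.lt p hp
  have h5 : (p : ℝ) - ρ p ≠ 0 := by linarith
  unfold sψ sg
  have : ∀ n, (if bad p n then -(((p : ℝ) - ρ p) / ρ p) else 1) *
      (if bad p n then -(((p : ℝ) - ρ p) / ρ p) else 1) =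
      if bad p n then (((p : ℝ) - ρ p) / ρ p) ^ 2 else 1 := by
    intro n; split_ifs <;> ring
  simp_rw [this]
  rw [sum_ite, sum_const, sum_const, nsmul_eq_mul, nsmul_eq_mul, H.card p hp]
  have h3 := card_filter_add_card_filter_not (s := range p) (bad p)
  rw [H.card p hp, card_range] at h3
  have h4 : (ρ p : ℝ) + ((range p).filter (fun n => ¬ bad p n)).card = p := by exact_mod_cast h3
  have : ((range p).filter (fun n => ¬ bad p n)).card = (p : ℝ) - ρ p := by linarith
  rw [this]
  field_simp
  ring

lemma Ψabs (H : SieveData ρ bad) {l : ℕ} (hl : Squarefree l) (n : ℕ) :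
    |∏ p ∈ l.primeFactors, sψ ρ bad p n| ≤ l := by
  rw [abs_prod]
  conv_rhs => rw [← Nat.prod_primeFactors_of_squarefree hl]
  push_cast
  exact prod_le_prod (fun _ _ => abs_nonneg _)
    fun p hp => H.ψabs (Nat.prime_of_mem_primeFactors hp) n

lemma pair (H : SieveData ρ bad) {l m z : ℕ} (hl : Squarefree l) (hm : Squarefree m)
    (hlz : l ≤ z) (hmz : m ≤ z) (K : ℕ) :
    |∑ n ∈ range K, (∏ p ∈ l.primeFactors, sψ ρ bad p n) * (∏ p ∈ m.primeFactors, sψ ρ bad p n)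
      - (if l = m then K / sG ρ l else 0)| ≤ 2 * (z:ℝ) ^ 4 := by
  set φ : ℕ → ℕ → ℝ := fun p n => (if p ∈ l.primeFactors then sψ ρ bad p n else 1) *
    (if p ∈ m.primeFactors then sψ ρ bad p n else 1) with hφ
  set T := l.primeFactors ∪ m.primeFactors with hT
  have hTp : ∀ p ∈ T, p.Prime := by
    intro p hp
    rcases mem_union.1 hp with h | h <;> exact Nat.prime_of_mem_primeFactors h
  have hφper : ∀ p ∈ T, ∀ n, φ p (n % p) = φ p n := by
    intro p _ n
    simp only [hφ, H.ψper]
  have e1 : ∀ n, (∏ p ∈ l.primeFactors, sψ ρ bad p n) * (∏ p ∈ m.primeFactors, sψ ρ bad p n)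
      = ∏ p ∈ T, φ p n := by
    intro n
    simp only [hφ]
    rw [prod_mul_distrib, prod_ite_mem, prod_ite_mem, union_inter_cancel_left,
      union_inter_cancel_right]
  set M := ∏ p ∈ T, p with hM
  have hM0 : 0 < M := prod_pos fun p hp => (hTp p hp).pos
  have hMle : M ≤ l * m := by
    have := prod_union_inter (s₁ := l.primeFactors) (s₂ := m.primeFactors) (f := fun p : ℕ => p)
    rw [Nat.prod_primeFactors_of_squarefree hl, Nat.prod_primeFactors_of_squarefree hm] at this
    rw [← this]
    apply Nat.le_mul_of_pos_right
    exact prod_pos fun p hp => (hTp p (mem_union_left _ (mem_inter.1 hp).1)).pos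
  have habs : ∀ n, |∏ p ∈ T, φ p n| ≤ (l : ℝ) * m := by
    intro n
    rw [← e1, abs_mul]
    gcongr
    · exact H.Ψabs hl n
    · exact H.Ψabs hm n
  have key := periodic_sum_err M hM0 (fun n => ∏ p ∈ T, φ p n)
    (prod_mod_periodic T φ hφper) _ habs K
  have mean : (K : ℝ) / M * ∑ n ∈ range M, ∏ p ∈ T, φ p n
      = if l = m then K / sG ρ l else 0 := by
    rw [hM, mean_prod T hTp φ hφper, ← hM]
    split_ifs with hlm
    · subst hlm
      have : ∏ p ∈ T, ∑ n ∈ range p, φ p n = ∏ p ∈ T, ((p:ℝ) / sg ρ p) := by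
        refine prod_congr rfl fun p hp => ?_
        rw [← H.ψmeansq (hTp p hp)]
        refine sum_congr rfl fun n _ => ?_
        have : p ∈ l.primeFactors := by simpa [hT] using hp
        simp only [hφ, if_pos this]
      rw [this, prod_div_distrib]
      have h1 : (∏ p ∈ T, (p:ℝ)) = M := by rw [hM]; push_cast; rfl
      have h2 : ∏ p ∈ T, sg ρ p = sG ρ l := by rw [hT, union_self]; rfl
      rw [h1, h2]
      have : (M:ℝ) ≠ 0 := by exact_mod_cast hM0.ne'
      field_simp
    · have hne : l.primeFactors ≠ m.primeFactors := by
        intro h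
        apply hlm
        rw [← Nat.prod_primeFactors_of_squarefree hl, h, Nat.prod_primeFactors_of_squarefree hm]
      have : ∃ p ∈ T, ¬ (p ∈ l.primeFactors ↔ p ∈ m.primeFactors) := by
        by_contra hcon
        push Not at hcon
        apply hne
        ext p
        by_cases hp : p ∈ T
        · exact hcon p hp
        · have := mt (mem_union_left m.primeFactors) hp
          have := mt (mem_union_right l.primeFactors) hp
          tauto
      obtain ⟨p, hp, hpn⟩ := this
      rw [prod_eq_zero hp, mul_zero]
      rw [← H.ψmean (hTp p hp)]
      refine sum_congr rfl fun n _ => ?_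
      simp only [hφ]
      by_cases h1 : p ∈ l.primeFactors <;> by_cases h2 : p ∈ m.primeFactors
      · tauto
      · rw [if_pos h1, if_neg h2, mul_one]
      · rw [if_neg h1, if_pos h2, one_mul]
      · tauto
  rw [mean] at key
  simp_rw [e1]
  refine key.trans ?_
  have a1 : (M:ℝ) ≤ l * m := by exact_mod_cast hMle
  have a2 : (l:ℝ) ≤ z := by exact_mod_cast hlz
  have a3 : (m:ℝ) ≤ z := by exact_mod_cast hmz
  calc 2 * (M:ℝ) * (l * m) ≤ 2 * (z * z) * (z * z) := by
        have : (l:ℝ) * m ≤ z * z := by gcongr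
        gcongr; exact a1.trans this
    _ = 2 * (z:ℝ)^4 := by ring

lemma Spos (H : SieveData ρ bad) {z : ℕ} (hz : 1 ≤ z) : 0 < sS ρ z := by
  unfold sS
  exact sum_pos (fun l _ => H.Gpos l) ⟨1, by simp [hz]⟩

theorem selberg (H : SieveData ρ bad) {z : ℕ} (hz : 1 ≤ z) (K : ℕ) :
    (((range K).filter (fun n => ∀ p, p.Prime → p ≤ z → ¬ bad p n)).card : ℝ)
      ≤ K / sS ρ z + 2 * (z:ℝ)^4 := by
  have hS := H.Spos hz
  set Q := (Icc 1 z).filter Squarefree with hQ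
  set F : ℕ → ℝ := fun n => ∑ l ∈ Q, sG ρ l * ∏ p ∈ l.primeFactors, sψ ρ bad p n with hF
  have hQm : ∀ l ∈ Q, Squarefree l ∧ l ≤ z := by
    intro l hl
    simp only [hQ, mem_filter, mem_Icc] at hl
    exact ⟨hl.2, hl.1.2⟩
  have h1 : (((range K).filter (fun n => ∀ p, p.Prime → p ≤ z → ¬ bad p n)).card : ℝ) * sS ρ z ^ 2
      ≤ ∑ n ∈ range K, F n ^ 2 := by
    rw [← nsmul_eq_mul, ← sum_const]
    refine le_trans (le_of_eq ?_) (sum_le_sum_of_subset_of_nonneg (filter_subset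
      (fun n => ∀ p, p.Prime → p ≤ z → ¬ bad p n) _) fun _ _ _ => sq_nonneg _)
    refine sum_congr rfl fun n hn => ?_
    have hn := (mem_filter.1 hn).2
    congr 1
    simp only [hF]
    unfold sS
    refine sum_congr rfl fun l hl => ?_
    rw [prod_eq_one, mul_one]
    intro p hp
    have hp' := Nat.prime_of_mem_primeFactors hp
    unfold sψ
    rw [if_neg]
    apply hn p hp'
    refine le_trans ?_ (hQm l hl).2
    exact Nat.le_of_mem_primeFactors hp
  have h2 : ∑ n ∈ range K, F n ^ 2 = ∑ l ∈ Q, ∑ m ∈ Q, sG ρ l * sG ρ m *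
      ∑ n ∈ range K, (∏ p ∈ l.primeFactors, sψ ρ bad p n) *
        (∏ p ∈ m.primeFactors, sψ ρ bad p n) := by
    simp only [hF, pow_two, sum_mul_sum]
    rw [sum_comm]
    refine sum_congr rfl fun l _ => ?_
    rw [sum_comm]
    refine sum_congr rfl fun m _ => ?_
    rw [mul_sum]
    refine sum_congr rfl fun n _ => ?_
    ring
  have h3 : ∑ n ∈ range K, F n ^ 2 ≤ ∑ l ∈ Q, ∑ m ∈ Q, sG ρ l * sG ρ m *
      ((if l = m then K / sG ρ l else 0) + 2 * (z:ℝ)^4) := by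
    rw [h2]
    refine sum_le_sum fun l hl => sum_le_sum fun m hm => ?_
    have := (abs_le.1 (H.pair (hQm l hl).1 (hQm m hm).1 (hQm l hl).2 (hQm m hm).2 K)).2
    have p1 := H.Gpos l
    have p2 := H.Gpos m
    gcongr
    linarith
  have h4 : ∑ l ∈ Q, ∑ m ∈ Q, sG ρ l * sG ρ m *
      ((if l = m then K / sG ρ l else 0) + 2 * (z:ℝ)^4) = K * sS ρ z + 2 * (z:ℝ)^4 * sS ρ z ^ 2 := by
    simp_rw [mul_add, sum_add_distrib]
    congr 1
    · simp only [mul_ite, mul_zero, sum_ite_eq]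
      unfold sS
      rw [mul_sum]
      refine sum_congr rfl fun l hl => ?_
      rw [if_pos hl]
      have p1 := (H.Gpos l).ne'
      field_simp
    · simp_rw [← sum_mul, ← mul_sum]
      rw [← sum_mul]
      unfold sS
      ring
  have h5 := h1.trans (h3.trans h4.le)
  have : (K / sS ρ z + 2 * (z:ℝ)^4) * sS ρ z ^ 2 = K * sS ρ z + 2 * (z:ℝ)^4 * sS ρ z ^ 2 := by
    field_simp
  rw [← this] at h5
  exact le_of_mul_le_mul_right h5 (by positivity)

end SieveData


lemma sum_le_of_section {α β : Type*} (X : Finset α) (Y : Finset β) (f : α → ℝ) (g : β → ℝ)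
    (e : β → α) (hg : ∀ y ∈ Y, 0 ≤ g y) (h : ∀ x ∈ X, ∃ y ∈ Y, e y = x ∧ f x ≤ g y) :
    ∑ x ∈ X, f x ≤ ∑ y ∈ Y, g y := by
  rcases X.eq_empty_or_nonempty with rfl | ⟨x0, hx0⟩
  · simpa using sum_nonneg hg
  have : Nonempty β := ⟨(h x0 hx0).choose⟩
  choose! i hi using h
  have hinj : Set.InjOn i X := by
    intro a ha b hb hab
    rw [← (hi a ha).2.1, ← (hi b hb).2.1, hab]
  calc ∑ x ∈ X, f x ≤ ∑ x ∈ X, g (i x) := sum_le_sum fun x hx => (hi x hx).2.2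
    _ = ∑ y ∈ X.image i, g y := (sum_image hinj).symm
    _ ≤ _ := sum_le_sum_of_subset_of_nonneg (by
        intro y hy
        obtain ⟨x, hx, rfl⟩ := mem_image.1 hy
        exact (hi x hx).1) fun y hy _ => hg y hy

lemma sum_inv_sq (w : ℕ) : ∑ k ∈ Icc 1 w, (1:ℝ) / k ^ 2 ≤ 2 := by
  have : ∀ w : ℕ, ∑ k ∈ Icc 1 (w+1), (1:ℝ) / k ^ 2 ≤ 2 - 1 / (w + 1) := by
    intro w
    induction w with
    | zero => simp; norm_num
    | succ w ih =>
      rw [sum_Icc_succ_top (by omega)]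
      have : (1:ℝ) / ((w + 1 + 1 : ℕ) : ℝ)^2 ≤ 1 / (w+1) - 1 / ((w:ℝ) + 1 + 1) := by
        push_cast
        rw [div_sub_div _ _ (by positivity) (by positivity), div_le_div_iff₀ (by positivity) (by positivity)]
        nlinarith
      push_cast at *
      linarith
  rcases w with _ | w
  · simp
  · refine (this w).trans ?_
    have : (0:ℝ) ≤ 1 / (w+1) := by positivity
    linarith

noncomputable def sσ (b : ℕ) : ℝ := ∑ d ∈ b.divisors, (1:ℝ) / d

noncomputable def Qf (w : ℕ) : Finset ℕ := (Icc 1 w).filter Squarefree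

lemma mem_Qf {w s : ℕ} : s ∈ Qf w ↔ (1 ≤ s ∧ s ≤ w) ∧ Squarefree s := by
  simp [Qf]

lemma step1 (w : ℕ) : ∑ m ∈ Icc 1 w, (1:ℝ) / m ≤ 2 * ∑ s ∈ Qf w, (1:ℝ) / s := by
  have h : ∑ m ∈ Icc 1 w, (1:ℝ) / m ≤ ∑ y ∈ Icc 1 w ×ˢ Qf w, ((1:ℝ) / y.1 ^ 2) * (1 / y.2) := by
    refine sum_le_of_section _ _ _ _ (fun y => y.1 ^ 2 * y.2) (fun _ _ => by positivity) ?_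
    intro m hm
    obtain ⟨hm1, hm2⟩ := mem_Icc.1 hm
    obtain ⟨s, k, hks, hs⟩ := Nat.sq_mul_squarefree m
    have hk0 : 0 < k := by
      rcases Nat.eq_zero_or_pos k with h | h
      · subst h; simp at hks; omega
      · exact h
    have hs0 : 0 < s := Nat.pos_of_ne_zero hs.ne_zero
    refine ⟨(k, s), ?_, hks, ?_⟩
    · simp only [mem_product, mem_Icc, mem_Qf]
      refine ⟨⟨hk0, ?_⟩, ⟨hs0, ?_⟩, hs⟩ <;> nlinarith [Nat.mul_le_mul hk0 hk0]
    · simp only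
      rw [← hks]; push_cast
      rw [one_div_mul_one_div]
  refine h.trans ?_
  rw [sum_product]
  simp only
  rw [← sum_mul_sum]
  exact mul_le_mul_of_nonneg_right (sum_inv_sq w) (sum_nonneg fun _ _ => by positivity)

lemma step2 (w b : ℕ) (hb : b ≠ 0) : ∑ s ∈ Qf w, (1:ℝ) / s ≤
    sσ b * ∑ s ∈ (Qf w).filter (fun s => s.Coprime b), (1:ℝ) / s := by
  unfold sσ
  rw [sum_mul_sum, ← sum_product']
  refine sum_le_of_section _ _ _ _ (fun y => y.1 * y.2) (fun _ _ => by positivity) ?_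
  intro s hs
  obtain ⟨⟨hs1, hs2⟩, hsq⟩ := mem_Qf.1 hs
  obtain ⟨t, ht⟩ := Nat.gcd_dvd_left s b
  have hsq' := hsq
  rw [ht] at hsq'
  have hsqt : Squarefree t := hsq'.squarefree_of_dvd (dvd_mul_left _ _)
  have hcop : (s.gcd b).Coprime t := Nat.coprime_of_squarefree_mul hsq'
  have ht0 : 0 < t := Nat.pos_of_ne_zero hsqt.ne_zero
  refine ⟨(s.gcd b, t), ?_, ht.symm, ?_⟩
  · simp only [mem_product, mem_filter, mem_Qf, Nat.mem_divisors]
    refine ⟨⟨Nat.gcd_dvd_right _ _, hb⟩, ⟨⟨ht0, ?_⟩, hsqt⟩, ?_⟩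
    · exact (Nat.le_of_dvd (by omega) ⟨_, by rw [mul_comm]; exact ht⟩).trans hs2
    · have hts : t ∣ s := ⟨s.gcd b, by rw [mul_comm]; exact ht⟩
      have h1 : t.gcd b ∣ s.gcd b := Nat.gcd_dvd_gcd_of_dvd_left _ hts
      exact Nat.eq_one_of_dvd_coprimes hcop h1 (Nat.gcd_dvd_left _ _)
  · simp only
    rw [one_div_mul_one_div]
    apply le_of_eq
    congr 1
    exact_mod_cast ht

lemma step3 (w b : ℕ) : (∑ s ∈ Qf w, (1:ℝ) / s) *
    (∑ s ∈ (Qf w).filter (fun s => s.Coprime b), (1:ℝ) / s) ≤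
    2 * ∑ y ∈ (Qf w ×ˢ Qf w).filter (fun y => y.1.Coprime y.2 ∧ y.2.Coprime b),
      (1:ℝ) / (y.1 * y.2) := by
  rw [sum_mul_sum, ← sum_product']
  have h : ∑ x ∈ Qf w ×ˢ (Qf w).filter (fun s => s.Coprime b), (1:ℝ) / x.1 * (1 / x.2)
    ≤ ∑ y ∈ Icc 1 w ×ˢ (Qf w ×ˢ Qf w).filter (fun y => y.1.Coprime y.2 ∧ y.2.Coprime b),
      ((1:ℝ) / y.1 ^ 2) * (1 / (y.2.1 * y.2.2)) := by
    refine sum_le_of_section _ _ _ _ (fun y => (y.1 * y.2.1, y.1 * y.2.2))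
      (fun _ _ => by positivity) ?_
    rintro ⟨m, n⟩ hmn
    simp only [mem_product, mem_filter, mem_Qf] at hmn
    obtain ⟨⟨⟨hm1, hm2⟩, hmq⟩, ⟨⟨hn1, hn2⟩, hnq⟩, hnb⟩ := hmn
    have hg : 0 < m.gcd n := Nat.gcd_pos_of_pos_left _ hm1
    obtain ⟨u, hu⟩ := Nat.gcd_dvd_left m n
    obtain ⟨v, hv⟩ := Nat.gcd_dvd_right m n
    have hum : u ∣ m := ⟨m.gcd n, by rw [mul_comm]; exact hu⟩
    have hvn : v ∣ n := ⟨m.gcd n, by rw [mul_comm]; exact hv⟩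
    refine ⟨(m.gcd n, u, v), ?_, by simp [← hu, ← hv], ?_⟩
    · simp only [mem_product, mem_filter, mem_Qf, mem_Icc]
      refine ⟨⟨hg, (Nat.gcd_le_left _ hm1).trans hm2⟩, ⟨⟨⟨Nat.pos_of_dvd_of_pos hum hm1,
        (Nat.le_of_dvd hm1 hum).trans hm2⟩, hmq.squarefree_of_dvd hum⟩,
        ⟨⟨Nat.pos_of_dvd_of_pos hvn hn1, (Nat.le_of_dvd hn1 hvn).trans hn2⟩,
          hnq.squarefree_of_dvd hvn⟩⟩, ?_, hnb.coprime_dvd_left hvn⟩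
      have := Nat.coprime_div_gcd_div_gcd hg
      have e1 : m / m.gcd n = u := Nat.div_eq_of_eq_mul_right hg hu
      have e2 : n / m.gcd n = v := Nat.div_eq_of_eq_mul_right hg hv
      rwa [e1, e2] at this
    · simp only
      rw [one_div_mul_one_div, one_div_mul_one_div]
      have e1 : (m:ℝ) = m.gcd n * u := by exact_mod_cast hu
      have e2 : (n:ℝ) = m.gcd n * v := by exact_mod_cast hv
      apply le_of_eq
      congr 1
      calc (m:ℝ) * n = (m.gcd n * u) * (m.gcd n * v) := by rw [← e1, ← e2]
        _ = _ := by ring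
  refine h.trans ?_
  rw [sum_product]
  simp only
  rw [← sum_mul_sum]
  exact mul_le_mul_of_nonneg_right (sum_inv_sq w) (sum_nonneg fun _ _ => by positivity)

lemma step4 (w b : ℕ) :
    ∑ y ∈ (Qf w ×ˢ Qf w).filter (fun y => y.1.Coprime y.2 ∧ y.2.Coprime b),
      (1:ℝ) / (y.1 * y.2) ≤
    ∑ n ∈ Qf (w * w), ∑ v ∈ n.divisors.filter (fun v => v.Coprime b), (1:ℝ) / n := by
  rw [sum_sigma' (Qf (w*w)) (fun n => n.divisors.filter (fun v => v.Coprime b))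
    (fun n _ => (1:ℝ)/n)]
  refine sum_le_of_section _ _ _ _ (fun y => (y.1 / y.2, y.2))
      (fun _ _ => by positivity) ?_
  rintro ⟨u, v⟩ h
  simp only [mem_product, mem_filter, mem_Qf] at h
  obtain ⟨⟨⟨⟨hu1, hu2⟩, huq⟩, ⟨hv1, hv2⟩, hvq⟩, huv, hvb⟩ := h
  refine ⟨⟨u * v, v⟩, ?_, ?_, ?_⟩
  · simp only [mem_sigma, mem_filter, mem_Qf, Nat.mem_divisors]
    refine ⟨⟨⟨Nat.mul_pos hu1 hv1, Nat.mul_le_mul hu2 hv2⟩,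
      (Nat.squarefree_mul huv).2 ⟨huq, hvq⟩⟩, ⟨dvd_mul_left _ _, (Nat.mul_pos hu1 hv1).ne'⟩, hvb⟩
  · simp only [Nat.mul_div_cancel _ hv1]
  · push_cast; exact le_rfl

lemma step5 (b n : ℕ) (hn : Squarefree n) (ρ : ℕ → ℕ)
    (hρ : ∀ p, ρ p = if p ∣ b then 1 else 2) (hlt : ∀ p, p.Prime → ρ p < p) :
    ∑ v ∈ n.divisors.filter (fun v => v.Coprime b), (1:ℝ) / n ≤ sG ρ n := by
  rw [sum_const, nsmul_eq_mul]
  have hcard : (n.divisors.filter (fun v => v.Coprime b)).card ≤ ∏ p ∈ n.primeFactors, ρ p := by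
    have : ∏ p ∈ n.primeFactors, ρ p = ((n.primeFactors.filter (fun p => ¬ p ∣ b)).powerset).card := by
      simp_rw [hρ]
      rw [prod_ite, prod_const_one, one_mul, prod_const, card_powerset]
    rw [this]
    refine card_le_card_of_injOn (fun v => v.primeFactors) ?_ ?_
    · intro v hv
      simp only [coe_filter, Nat.mem_divisors, Set.mem_ofPred_eq] at hv
      simp only [coe_powerset, Set.mem_preimage, Set.mem_powerset_iff, coe_subset]
      intro p hp
      have hp' := Nat.prime_of_mem_primeFactors hp
      have hpv := Nat.dvd_of_mem_primeFactors hp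
      rw [mem_filter]
      refine ⟨Nat.primeFactors_mono hv.1.1 hv.1.2 hp, fun hpb => ?_⟩
      exact hp'.one_lt.ne' (Nat.eq_one_of_dvd_coprimes hv.2 hpv hpb)
    · intro v hv v' hv' hvv
      simp only [coe_filter, Nat.mem_divisors, Set.mem_ofPred_eq] at hv hv'
      simp only at hvv
      rw [← Nat.prod_primeFactors_of_squarefree (hn.squarefree_of_dvd hv.1.1), hvv,
        Nat.prod_primeFactors_of_squarefree (hn.squarefree_of_dvd hv'.1.1)]
  have h2 : ((∏ p ∈ n.primeFactors, ρ p : ℕ) : ℝ) * (1 / n) ≤ sG ρ n := by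
    have : (n:ℝ) = ∏ p ∈ n.primeFactors, (p:ℝ) := by
      conv_lhs => rw [← Nat.prod_primeFactors_of_squarefree hn]
      push_cast; rfl
    rw [mul_one_div, this]
    push_cast
    rw [← prod_div_distrib]
    unfold sG sg
    refine prod_le_prod (fun _ _ => by positivity) fun p hp => ?_
    have h3 : (ρ p : ℝ) < p := by exact_mod_cast hlt p (Nat.prime_of_mem_primeFactors hp)
    have h4 : (0:ℝ) ≤ ρ p := by positivity
    apply div_le_div_of_nonneg_left h4 <;> linarith
  refine le_trans ?_ h2
  gcongr

lemma S_lower (w b : ℕ) (hb : b ≠ 0) (ρ : ℕ → ℕ)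
    (hρ : ∀ p, ρ p = if p ∣ b then 1 else 2) (hlt : ∀ p, p.Prime → ρ p < p) :
    (∑ m ∈ Icc 1 w, (1:ℝ) / m) ^ 2 ≤ 8 * sσ b * sS ρ (w * w) := by
  have h1 := step1 w
  have h2 := step2 w b hb
  have h3 := step3 w b
  have h4 := step4 w b
  have h5 : ∑ n ∈ Qf (w * w), ∑ v ∈ n.divisors.filter (fun v => v.Coprime b), (1:ℝ) / n
      ≤ sS ρ (w * w) := sum_le_sum fun n hn => step5 b n (mem_Qf.1 hn).2 ρ hρ hlt
  have hσ : 0 ≤ sσ b := sum_nonneg fun _ _ => by positivity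
  have hH : 0 ≤ ∑ m ∈ Icc 1 w, (1:ℝ) / m := sum_nonneg fun _ _ => by positivity
  set B := ∑ s ∈ Qf w, (1:ℝ) / s
  set C := ∑ s ∈ (Qf w).filter (fun s => s.Coprime b), (1:ℝ) / s
  have hB : 0 ≤ B := sum_nonneg fun _ _ => by positivity
  calc (∑ m ∈ Icc 1 w, (1:ℝ) / m) ^ 2 ≤ (2 * B) ^ 2 := by gcongr
    _ = 4 * (B * B) := by ring
    _ ≤ 4 * (B * (sσ b * C)) := by gcongr
    _ = 4 * sσ b * (B * C) := by ring
    _ ≤ 4 * sσ b * (2 * sS ρ (w * w)) := by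
      exact mul_le_mul_of_nonneg_left (by linarith) (by positivity)
    _ = _ := by ring


def sbad (a : ℕ) (p n : ℕ) : Prop := p ∣ n ∨ (¬ p ∣ 2 * a ∧ p ∣ a * n + 1)

noncomputable def sρ (a : ℕ) (p : ℕ) : ℕ := if p ∣ 2 * a then 1 else 2

lemma sρ_lt (a p : ℕ) (hp : p.Prime) : sρ a p < p := by
  unfold sρ
  split_ifs with h
  · exact hp.one_lt
  · rcases hp.two_le.lt_or_eq with h2 | h2
    · exact h2
    · exact absurd (h2 ▸ dvd_mul_right 2 a) h

lemma sieveData (a : ℕ) : SieveData (sρ a) (sbad a) where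
  pos p _ := by unfold sρ; split_ifs <;> norm_num
  lt := sρ_lt a
  per p n := by
    unfold sbad
    rw [Nat.dvd_mod_iff (dvd_refl p)]
    have h : p ∣ a * (n % p) + 1 ↔ p ∣ a * n + 1 := by
      have : a * (n % p) + 1 ≡ a * n + 1 [MOD p] :=
        Nat.ModEq.add_right _ (Nat.ModEq.mul_left _ (Nat.mod_modEq n p))
      exact this.dvd_iff (dvd_refl p)
    rw [h]
  card p hp := by
    have : Fact p.Prime := ⟨hp⟩
    unfold sρ
    split_ifs with h
    · have : (range p).filter (sbad a p) = {0} := by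
        ext n
        simp only [mem_filter, mem_range, mem_singleton, sbad, h, not_true, false_and, or_false]
        constructor
        · rintro ⟨h1, h2⟩
          exact Nat.eq_zero_of_dvd_of_lt h2 h1
        · rintro rfl
          exact ⟨hp.pos, dvd_zero _⟩
      rw [this, card_singleton]
    · have ha : (a : ZMod p) ≠ 0 := by
        intro h0
        rw [ZMod.natCast_eq_zero_iff] at h0
        exact h (h0.mul_left 2)
      set r := (-(a : ZMod p)⁻¹).val with hr
      have hr' : ((r : ℕ) : ZMod p) = -(a : ZMod p)⁻¹ := by rw [hr, ZMod.natCast_zmod_val]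
      have key : ∀ n, p ∣ a * n + 1 ↔ (n : ZMod p) = (r : ℕ) := by
        intro n
        rw [← ZMod.natCast_eq_zero_iff, hr']
        push_cast
        constructor
        · intro h1
          have : (a : ZMod p) * n = -1 := eq_neg_of_add_eq_zero_left h1
          field_simp
          rw [mul_comm] at this
          rw [mul_comm]
          first | exact this | (rw [mul_comm]; exact this)
        · intro h1
          rw [h1]; field_simp; ring
      have hr0 : r ≠ 0 := by
        intro h0
        rw [h0] at hr'
        simp at hr'
        exact ha hr'
      have : (range p).filter (sbad a p) = {0, r} := by
        ext n
        simp only [mem_filter, mem_range, mem_insert, mem_singleton, sbad, h, not_false_eq_true,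
          true_and, key]
        constructor
        · rintro ⟨h1, h2 | h2⟩
          · left; exact Nat.eq_zero_of_dvd_of_lt h2 h1
          · right
            rw [ZMod.natCast_eq_natCast_iff] at h2
            exact Nat.ModEq.eq_of_lt_of_lt h2 h1 (ZMod.val_lt _)
        · rintro (rfl | rfl)
          · exact ⟨hp.pos, Or.inl (dvd_zero _)⟩
          · exact ⟨ZMod.val_lt _, Or.inr rfl⟩
      rw [this, card_pair hr0.symm]

noncomputable def hsum (w : ℕ) : ℝ := ∑ m ∈ Icc 1 w, (1:ℝ) / m

lemma sσ_nonneg (b : ℕ) : 0 ≤ sσ b := sum_nonneg fun _ _ => by positivity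

lemma hsum_ge (w : ℕ) : Real.log (w + 1) ≤ hsum w := by
  have := log_add_one_le_harmonic w
  rw [harmonic_eq_sum_Icc] at this
  push_cast at this
  simpa [hsum] using this

lemma hsum_le (w : ℕ) : hsum w ≤ 1 + Real.log w := by
  have := harmonic_le_one_add_log w
  rw [harmonic_eq_sum_Icc] at this
  push_cast at this
  simpa [hsum] using this

lemma sieve_count (a w : ℕ) (ha : 1 ≤ a) (hw : 1 ≤ w) (K : ℕ) :
    (((range K).filter (fun n => ∀ p, p.Prime → p ≤ w * w → ¬ sbad a p n)).card : ℝ)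
      ≤ K * (8 * sσ (2 * a) / hsum w ^ 2) + 2 * (w:ℝ)^8 := by
  have H := sieveData a
  have hww : 1 ≤ w * w := Nat.mul_pos hw hw
  have h1 := H.selberg hww K
  have h2 := S_lower w (2 * a) (by omega) (sρ a) (fun _ => rfl) (sρ_lt a)
  have hS := H.Spos hww
  have hh : 0 < hsum w := by
    have := hsum_ge w
    have h3 : 0 < Real.log (w + 1) := Real.log_pos (by
      have : (1:ℝ) ≤ w := by exact_mod_cast hw
      linarith)
    linarith
  change hsum w ^ 2 ≤ _ at h2
  have h3 : (K:ℝ) / sS (sρ a) (w * w) ≤ K * (8 * sσ (2 * a) / hsum w ^ 2) := by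
    rw [div_eq_mul_inv]
    apply mul_le_mul_of_nonneg_left _ (by positivity)
    rw [inv_eq_one_div, div_le_div_iff₀ hS (by positivity)]
    linarith
  refine h1.trans ?_
  have : (((w * w : ℕ) : ℝ)) ^ 4 = (w:ℝ) ^ 8 := by push_cast; ring
  rw [this]
  linarith

lemma sum_sσ (X : ℕ) : ∑ b ∈ Icc 1 X, sσ b / b ≤ 2 * hsum X := by
  have h : ∑ b ∈ Icc 1 X, sσ b / b ≤ ∑ y ∈ Icc 1 X ×ˢ Icc 1 X, ((1:ℝ) / y.1 ^ 2) * (1 / y.2) := by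
    unfold sσ
    simp_rw [sum_div]
    rw [sum_sigma' (Icc 1 X) (fun b => b.divisors) (fun b d => (1:ℝ) / d / b)]
    refine sum_le_of_section _ _ _ _ (fun y => ⟨y.1 * y.2, y.1⟩) (fun _ _ => by positivity) ?_
    rintro ⟨b, d⟩ hbd
    simp only [mem_sigma, mem_Icc, Nat.mem_divisors] at hbd
    obtain ⟨⟨hb1, hb2⟩, ⟨c, rfl⟩, _⟩ := hbd
    have hd0 : 0 < d := Nat.pos_of_mul_pos_right hb1
    have hc0 : 0 < c := Nat.pos_of_mul_pos_left hb1
    refine ⟨(d, c), ?_, rfl, ?_⟩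
    · simp only [mem_product, mem_Icc]
      refine ⟨⟨hd0, ?_⟩, hc0, ?_⟩ <;> nlinarith
    · simp only
      push_cast
      apply le_of_eq
      field_simp
  refine h.trans ?_
  rw [sum_product]
  simp only
  rw [← sum_mul_sum]
  exact mul_le_mul_of_nonneg_right (sum_inv_sq X) (sum_nonneg fun _ _ => by positivity)

lemma sum_sσ2 (A : ℕ) : ∑ a ∈ Icc 1 A, sσ (2 * a) / a ≤ 4 * hsum (2 * A) := by
  have h : ∑ a ∈ Icc 1 A, sσ (2 * a) / a ≤ ∑ b ∈ Icc 1 (2 * A), 2 * (sσ b / b) := by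
    refine sum_le_of_section _ _ _ _ (fun y => y / 2) (fun b _ => by
      have := sσ_nonneg b
      positivity) ?_
    intro a ha
    obtain ⟨h1, h2⟩ := mem_Icc.1 ha
    refine ⟨2 * a, mem_Icc.2 ⟨by omega, by omega⟩, by simp, ?_⟩
    push_cast
    apply le_of_eq
    have : (a:ℝ) ≠ 0 := by positivity
    field_simp
  rw [← mul_sum] at h
  have := sum_sσ (2 * A)
  linarith

lemma Pplus_cases (n : ℕ) : Pplus n = 1 ∨ ((Pplus n).Prime ∧ Pplus n ∣ n) := by
  have h : ∀ l : List ℕ, l.foldr max 1 = 1 ∨ l.foldr max 1 ∈ l := by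
    intro l
    induction l with
    | nil => simp
    | cons x l ih =>
      simp only [List.foldr_cons, List.mem_cons]
      rcases le_total x (l.foldr max 1) with h | h
      · rw [max_eq_right h]; tauto
      · rw [max_eq_left h]; tauto
  rcases h n.primeFactorsList with h | h
  · exact Or.inl h
  · exact Or.inr ⟨Nat.prime_of_mem_primeFactorsList h, Nat.dvd_of_mem_primeFactorsList h⟩


lemma prime_decomp {x ε : ℝ} (hx : 2 ≤ x) (hε : 0 < ε) (hε2 : ε ≤ 1 / 2) {w p : ℕ}
    (hw : (w:ℝ) * w < x ^ (1/4 : ℝ)) (hp : p.Prime) (hpx : (p:ℝ) ≤ x) (hpx' : x ^ (1/2:ℝ) < p)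
    (hP : (p:ℝ) ^ (1 - ε) ≤ (Pplus (p - 1) : ℝ)) :
    ∃ a n : ℕ, 1 ≤ a ∧ (a:ℝ) ≤ x ^ ε ∧ (n:ℝ) ≤ x / a ∧ a * n + 1 = p ∧
      ∀ r, r.Prime → r ≤ w * w → ¬ sbad a r n := by
  have hx0 : 0 < x := by linarith
  have hp1 : (1:ℝ) ≤ p := by exact_mod_cast hp.one_lt.le
  have hp0 : (0:ℝ) < p := by linarith
  have hq4 : x ^ (1/4:ℝ) ≤ (Pplus (p - 1) : ℝ) := by
    calc x ^ (1/4:ℝ) = (x ^ (1/2:ℝ)) ^ (1/2:ℝ) := by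
          rw [← Real.rpow_mul hx0.le]; norm_num
      _ ≤ (p:ℝ) ^ (1/2:ℝ) := by gcongr
      _ ≤ (p:ℝ) ^ (1 - ε) := Real.rpow_le_rpow_of_exponent_le hp1 (by linarith)
      _ ≤ _ := hP
  have h14 : 1 < x ^ (1/4:ℝ) := Real.one_lt_rpow (by linarith) (by norm_num)
  rcases Pplus_cases (p - 1) with h1 | ⟨hq, hqd⟩
  · rw [h1] at hq4
    push_cast at hq4
    linarith
  set q := Pplus (p - 1)
  obtain ⟨a, ha⟩ := hqd
  have hp2 := hp.two_le
  have ha0 : 1 ≤ a := by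
    rcases Nat.eq_zero_or_pos a with h | h
    · subst h; omega
    · exact h
  have hpa : a * q + 1 = p := by rw [mul_comm, ← ha]; omega
  have hpaR : (a:ℝ) * q + 1 = p := by exact_mod_cast hpa
  have haR : (1:ℝ) ≤ a := by exact_mod_cast ha0
  refine ⟨a, q, ha0, ?_, ?_, hpa, ?_⟩
  · have h1 : (a:ℝ) * (p:ℝ) ^ (1 - ε) ≤ (p:ℝ) ^ ε * (p:ℝ) ^ (1 - ε) := by
      rw [← Real.rpow_add hp0, show ε + (1 - ε) = 1 by ring, Real.rpow_one]
      have : (a:ℝ) * (p:ℝ) ^ (1 - ε) ≤ a * q := by gcongr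
      linarith
    have h2 : (a:ℝ) ≤ (p:ℝ) ^ ε := le_of_mul_le_mul_right h1 (by positivity)
    exact h2.trans (Real.rpow_le_rpow hp0.le hpx hε.le)
  · rw [le_div_iff₀ (by linarith)]
    linarith
  · intro r hr hrw hbad
    have hwq : w * w < q := by
      have : (w:ℝ) * w < q := by linarith
      exact_mod_cast this
    rcases hbad with h | ⟨_, h⟩
    · have := (Nat.prime_dvd_prime_iff_eq hr hq).1 h
      omega
    · rw [hpa] at h
      have := (Nat.prime_dvd_prime_iff_eq hr hp).1 h
      have : q ≤ a * q := Nat.le_mul_of_pos_left _ ha0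
      omega

lemma main_count {x ε : ℝ} (hx : 2 ≤ x) (hε : 0 < ε) (hε2 : ε ≤ 1 / 2) :
    (((Finset.Icc 1 ⌊x⌋₊).filter
      (fun p : ℕ => p.Prime ∧ (p:ℝ) ^ (1 - ε) ≤ (Pplus (p - 1) : ℝ))).card : ℝ) ≤
      65536 * x * (2 + ε * Real.log x) / Real.log x ^ 2 + 3 * x ^ (3/4:ℝ) := by
  have hx0 : 0 < x := by linarith
  have hx1 : 1 ≤ x := by linarith
  have hL : 0 < Real.log x := Real.log_pos (by linarith)
  set w := ⌊x ^ (1/32:ℝ)⌋₊ with hw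
  set A := ⌊x ^ ε⌋₊ with hA
  have hwle : (w:ℝ) ≤ x ^ (1/32:ℝ) := Nat.floor_le (by positivity)
  have hw1 : 1 ≤ w := by
    rw [hw, Nat.one_le_floor_iff]
    exact Real.one_le_rpow hx1 (by norm_num)
  have hAle : (A:ℝ) ≤ x ^ ε := Nat.floor_le (by positivity)
  have hA1 : 1 ≤ A := by
    rw [hA, Nat.one_le_floor_iff]
    exact Real.one_le_rpow hx1 hε.le
  have hw4 : (w:ℝ) * w < x ^ (1/4:ℝ) := by
    calc (w:ℝ) * w ≤ x ^ (1/32:ℝ) * x ^ (1/32:ℝ) := by gcongr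
      _ = x ^ (1/16:ℝ) := by rw [← Real.rpow_add hx0]; norm_num
      _ < _ := Real.rpow_lt_rpow_of_exponent_lt (by linarith) (by norm_num)
  have hw8 : (w:ℝ) ^ 8 ≤ x ^ (1/4:ℝ) := by
    calc (w:ℝ) ^ 8 ≤ (x ^ (1/32:ℝ)) ^ 8 := by gcongr
      _ = x ^ (1/4:ℝ) := by
        rw [← Real.rpow_natCast, ← Real.rpow_mul hx0.le]; norm_num
  set R : ℕ → Finset ℕ := fun a => ((range (⌊x / a⌋₊ + 1)).filter
    (fun n => ∀ r, r.Prime → r ≤ w * w → ¬ sbad a r n)) with hR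
  have hsub : (Finset.Icc 1 ⌊x⌋₊).filter
      (fun p : ℕ => p.Prime ∧ (p:ℝ) ^ (1 - ε) ≤ (Pplus (p - 1) : ℝ)) ⊆
      Icc 1 ⌊x ^ (1/2:ℝ)⌋₊ ∪ (Icc 1 A).biUnion (fun a => (R a).image (fun n => a * n + 1)) := by
    intro p hp
    simp only [mem_filter, mem_Icc] at hp
    obtain ⟨⟨hp1, hp2⟩, hpp, hP⟩ := hp
    rw [mem_union]
    by_cases hps : (p:ℝ) ≤ x ^ (1/2:ℝ)
    · left
      exact mem_Icc.2 ⟨hp1, Nat.le_floor hps⟩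
    · right
      obtain ⟨a, n, ha, hax, hn, hpan, hs⟩ := prime_decomp hx hε hε2 hw4 hpp
        ((Nat.le_floor_iff hx0.le).1 hp2) (not_le.1 hps) hP
      rw [mem_biUnion]
      refine ⟨a, mem_Icc.2 ⟨ha, Nat.le_floor hax⟩, mem_image.2 ⟨n, ?_, hpan⟩⟩
      simp only [hR, mem_filter, mem_range]
      exact ⟨Nat.lt_succ_of_le (Nat.le_floor hn), hs⟩
  have hc1 := (card_le_card hsub).trans ((card_union_le _ _).trans
    (Nat.add_le_add_left (card_biUnion_le) _))
  have hc2 : (((Finset.Icc 1 ⌊x⌋₊).filter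
      (fun p : ℕ => p.Prime ∧ (p:ℝ) ^ (1 - ε) ≤ (Pplus (p - 1) : ℝ))).card : ℝ) ≤
      x ^ (1/2:ℝ) + ∑ a ∈ Icc 1 A, ((R a).card : ℝ) := by
    have h1 : ((Icc 1 ⌊x ^ (1/2:ℝ)⌋₊).card : ℝ) ≤ x ^ (1/2:ℝ) := by
      rw [Nat.card_Icc, Nat.add_sub_cancel]
      exact Nat.floor_le (by positivity)
    have h2 : ((∑ a ∈ Icc 1 A, ((R a).image (fun n => a * n + 1)).card : ℕ) : ℝ) ≤
        ∑ a ∈ Icc 1 A, ((R a).card : ℝ) := by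
      push_cast
      refine sum_le_sum fun a _ => ?_
      exact_mod_cast card_image_le
    have h3 : (((Finset.Icc 1 ⌊x⌋₊).filter
      (fun p : ℕ => p.Prime ∧ (p:ℝ) ^ (1 - ε) ≤ (Pplus (p - 1) : ℝ))).card : ℝ) ≤
      ((Icc 1 ⌊x ^ (1/2:ℝ)⌋₊).card : ℝ) +
        ((∑ a ∈ Icc 1 A, ((R a).image (fun n => a * n + 1)).card : ℕ) : ℝ) := by
      exact_mod_cast hc1
    linarith
  have hlogw : Real.log x / 32 ≤ hsum w := by
    refine le_trans ?_ (hsum_ge w)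
    have h1 : x ^ (1/32:ℝ) ≤ (w:ℝ) + 1 := (Nat.lt_floor_add_one _).le
    have h2 := Real.log_le_log (by positivity) h1
    rw [Real.log_rpow hx0] at h2
    linarith
  have hh : 0 < hsum w := by linarith [div_pos hL (by norm_num : (0:ℝ) < 32)]
  have hRa : ∀ a ∈ Icc 1 A, ((R a).card : ℝ) ≤
      16 * x / hsum w ^ 2 * (sσ (2 * a) / a) + 2 * x ^ (1/4:ℝ) := by
    intro a ha
    obtain ⟨ha1, haA⟩ := mem_Icc.1 ha
    have h1 := sieve_count a w ha1 hw1 (⌊x / a⌋₊ + 1)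
    have haR : (1:ℝ) ≤ a := by exact_mod_cast ha1
    have hax : (a:ℝ) ≤ x := by
      have h2 : (a:ℝ) ≤ A := by exact_mod_cast haA
      have h3 : x ^ ε ≤ x ^ (1:ℝ) := Real.rpow_le_rpow_of_exponent_le hx1 (by linarith)
      rw [Real.rpow_one] at h3
      linarith
    have hxa : 1 ≤ x / a := by rw [le_div_iff₀ (by linarith)]; linarith
    have h4 : (((⌊x / a⌋₊ + 1 : ℕ)) : ℝ) ≤ 2 * (x / a) := by
      push_cast
      have := Nat.floor_le (by linarith : 0 ≤ x / a)
      linarith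
    have hσ := sσ_nonneg (2 * a)
    have h5 : (((⌊x / a⌋₊ + 1 : ℕ)) : ℝ) * (8 * sσ (2 * a) / hsum w ^ 2) ≤
        2 * (x / a) * (8 * sσ (2 * a) / hsum w ^ 2) := by gcongr
    have h6 : 2 * (x / a) * (8 * sσ (2 * a) / hsum w ^ 2) =
      16 * x / hsum w ^ 2 * (sσ (2 * a) / a) := by ring
    linarith
  have hsum1 : ∑ a ∈ Icc 1 A, ((R a).card : ℝ) ≤
      16 * x / hsum w ^ 2 * (4 * hsum (2 * A)) + A * (2 * x ^ (1/4:ℝ)) := by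
    refine (sum_le_sum hRa).trans ?_
    rw [sum_add_distrib, ← mul_sum, sum_const, Nat.card_Icc, Nat.add_sub_cancel, nsmul_eq_mul]
    gcongr
    exact sum_sσ2 A
  have hA2 : hsum (2 * A) ≤ 2 + ε * Real.log x := by
    refine (hsum_le _).trans ?_
    push_cast
    have hA0 : (0:ℝ) < A := by exact_mod_cast hA1
    rw [Real.log_mul (by norm_num) hA0.ne']
    have h1 := Real.log_le_log hA0 hAle
    rw [Real.log_rpow hx0] at h1
    have := Real.log_two_lt_d9
    linarith
  have hterm1 : 16 * x / hsum w ^ 2 * (4 * hsum (2 * A)) ≤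
      65536 * x * (2 + ε * Real.log x) / Real.log x ^ 2 := by
    have hnn : 0 ≤ hsum (2 * A) := sum_nonneg fun _ _ => by positivity
    calc 16 * x / hsum w ^ 2 * (4 * hsum (2 * A))
        ≤ 16 * x / (Real.log x / 32) ^ 2 * (4 * (2 + ε * Real.log x)) := by gcongr
      _ = _ := by field_simp; ring
  have hterm2 : A * (2 * x ^ (1/4:ℝ)) ≤ 2 * x ^ (3/4:ℝ) := by
    have h1 : x ^ ε ≤ x ^ (1/2:ℝ) := Real.rpow_le_rpow_of_exponent_le hx1 hε2
    have h2 : x ^ (3/4:ℝ) = x ^ (1/2:ℝ) * x ^ (1/4:ℝ) := by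
      rw [← Real.rpow_add hx0]; norm_num
    rw [h2]
    have h3 : (A:ℝ) * x ^ (1/4:ℝ) ≤ x ^ (1/2:ℝ) * x ^ (1/4:ℝ) := by
      gcongr; linarith
    linarith
  have hterm3 : x ^ (1/2:ℝ) ≤ x ^ (3/4:ℝ) :=
    Real.rpow_le_rpow_of_exponent_le hx1 (by norm_num)
  linarith

lemma pi_lower : ∀ᶠ x : ℝ in atTop, x / 2 / Real.log x ≤ (Nat.primeCounting ⌊x⌋₊ : ℝ) := by
  have h1 : ∀ᶠ x : ℝ in atTop, Real.log x ≤ (1/20) * x := by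
    have := Real.isLittleO_log_id_atTop.bound (by norm_num : (0:ℝ) < 1/20)
    filter_upwards [this, eventually_ge_atTop 1] with x hx h1
    simp only [id, Real.norm_eq_abs] at hx
    rw [abs_of_nonneg (by linarith : 0 ≤ x)] at hx
    exact (le_abs_self _).trans hx
  have h2 : ∀ᶠ x : ℝ in atTop, Real.log (x + 2) ≤ (1/20) * (x + 2) :=
    (tendsto_atTop_add_const_right atTop (2:ℝ) tendsto_id).eventually h1
  filter_upwards [h2, eventually_ge_atTop 100] with x hx h100
  refine le_trans ?_ (Chebyshev.pi_ge' (by linarith : 1 < x))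
  have : 0 < Real.log x := Real.log_pos (by linarith)
  gcongr
  have := Real.log_two_gt_d9
  nlinarith

lemma small_term {ε : ℝ} (hε : 0 < ε) :
    ∀ᶠ x : ℝ in atTop, 3 * x ^ (3/4:ℝ) ≤ ε * x / Real.log x := by
  have := (isLittleO_log_rpow_atTop (by norm_num : (0:ℝ) < 1/4)).bound
    (by positivity : (0:ℝ) < ε / 3)
  filter_upwards [this, eventually_ge_atTop 2] with x hx h2
  have hx0 : 0 < x := by linarith
  have hL : 0 < Real.log x := Real.log_pos (by linarith)
  rw [Real.norm_eq_abs, Real.norm_eq_abs, abs_of_pos hL, abs_of_pos (by positivity)] at hx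
  rw [le_div_iff₀ hL]
  have e : x = x ^ (3/4:ℝ) * x ^ (1/4:ℝ) := by
    rw [← Real.rpow_add hx0]; norm_num
  calc 3 * x ^ (3/4:ℝ) * Real.log x ≤ 3 * x ^ (3/4:ℝ) * (ε / 3 * x ^ (1/4:ℝ)) := by gcongr
    _ = ε * (x ^ (3/4:ℝ) * x ^ (1/4:ℝ)) := by ring
    _ = ε * x := by rw [← e]

lemma ev_bound {ε : ℝ} (hε : 0 < ε) : ∀ᶠ x : ℝ in atTop,
    (((Finset.Icc 1 ⌊x⌋₊).filter
              (fun p : ℕ => p.Prime ∧ (p:ℝ) ^ (1 - ε) ≤ (Pplus (p - 1) : ℝ))).card : ℝ) /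
            (Nat.primeCounting ⌊x⌋₊ : ℝ) ≤ 300000 * ε := by
  rcases le_or_gt ε (1/2) with h | h
  · have hlog : ∀ᶠ x : ℝ in atTop, 2 / ε ≤ Real.log x :=
      Real.tendsto_log_atTop.eventually_ge_atTop _
    filter_upwards [pi_lower, small_term hε, eventually_ge_atTop 2, hlog] with x h1 h2 h3 h4
    have hm := main_count h3 hε h
    have hL : 0 < Real.log x := Real.log_pos (by linarith)
    have hpos : 0 < x / 2 / Real.log x := by positivity
    rw [div_le_iff₀ (by linarith)]
    rw [div_le_iff₀ hε] at h4
    have h5 : 65536 * x * (2 + ε * Real.log x) / Real.log x ^ 2 ≤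
        65536 * x * (2 * ε * Real.log x) / Real.log x ^ 2 := by
      gcongr; linarith
    have h6 : 65536 * x * (2 * ε * Real.log x) / Real.log x ^ 2 = 131072 * ε * x / Real.log x := by
      field_simp; ring
    have h7 : 300000 * ε * (x / 2 / Real.log x) ≤
      300000 * ε * (Nat.primeCounting ⌊x⌋₊ : ℝ) := by gcongr
    have h8 : 300000 * ε * (x / 2 / Real.log x) =
      131072 * ε * x / Real.log x + ε * x / Real.log x + 18927 * (ε * x / Real.log x) := by
      field_simp; ring
    have h9 : 0 ≤ ε * x / Real.log x := by positivity
    linarith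
  · filter_upwards with x
    have hle : ((Finset.Icc 1 ⌊x⌋₊).filter
              (fun p : ℕ => p.Prime ∧ (p:ℝ) ^ (1 - ε) ≤ (Pplus (p - 1) : ℝ))).card ≤
            Nat.primeCounting ⌊x⌋₊ := by
      rw [← Nat.primesLE_card_eq_primeCounting]
      apply card_le_card
      intro p hp
      simp only [mem_filter, mem_Icc] at hp
      rw [Nat.mem_primesLE]
      exact ⟨hp.1.2, hp.2.1⟩
    have : (((Finset.Icc 1 ⌊x⌋₊).filter
              (fun p : ℕ => p.Prime ∧ (p:ℝ) ^ (1 - ε) ≤ (Pplus (p - 1) : ℝ))).card : ℝ) /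
            (Nat.primeCounting ⌊x⌋₊ : ℝ) ≤ 1 :=
      div_le_one_of_le₀ (by exact_mod_cast hle) (by positivity)
    linarith

/-- Erdős: there is an absolute constant `K > 0` so that for every
`ε > 0`, `limsup_{x→∞} #{p ≤ x : P⁺(p-1) ≥ p^{1-ε}} / π(x) ≤ K ε`. -/
theorem erdos_shifted_primes :
    ∃ K : ℝ, 0 < K ∧ ∀ ε : ℝ, 0 < ε →
      Filter.limsup (fun x : ℝ =>
          (((Finset.Icc 1 ⌊x⌋₊).filter
              (fun p : ℕ => p.Prime ∧ (p:ℝ) ^ (1 - ε) ≤ (Pplus (p - 1) : ℝ))).card : ℝ) /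
            (Nat.primeCounting ⌊x⌋₊ : ℝ))
        atTop ≤ K * ε := by
  refine ⟨300000, by norm_num, fun ε hε => ?_⟩
  refine Filter.limsup_le_of_le ?_ (ev_bound hε)
  refine Filter.IsCoboundedUnder.of_frequently_ge (a := 0) (Filter.Frequently.of_forall fun x => ?_)
  positivity
end

section
/- Suppose the sequence (a_n) of nonnegative reals has level of distribution ϑ ∈ (0,1] with density g. Let 0 < α < c be real numbers with 2c < ϑ. For x ≥ 2 let S(x) be the set of positive integers n ≤ x such that there exists a prime p with x^α ≤ p ≤ x^c and p² ∣ n. Then ∑_{n ∈ S(x)} a_n = o(N(x)) as x → ∞. -/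
open Finset Filter Real

open scoped Classical

theorem sum_biUnion_le_aux (P : Finset ℕ) (f : ℕ → Finset ℕ) (a : ℕ → ℝ)
    (ha : ∀ n, 0 ≤ a n) : ∑ n ∈ P.biUnion f, a n ≤ ∑ p ∈ P, ∑ n ∈ f p, a n := by
  induction P using Finset.induction_on with
  | empty => simp
  | insert p s hp ih =>
    rw [Finset.biUnion_insert, Finset.sum_insert hp]
    have h := Finset.sum_union_inter (s₁ := f p) (s₂ := s.biUnion f) (f := a)
    have h2 : 0 ≤ ∑ n ∈ f p ∩ s.biUnion f, a n := Finset.sum_nonneg fun n _ => ha n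
    linarith

/-- for a sequence with level of distribution `ϑ` and `0 < α < c`,
`2c < ϑ`, the mass of `n ≤ x` divisible by `p²` for some prime `x^α ≤ p ≤ x^c`
is `o(N(x))`. -/
theorem repeated_large_prime_factor_rare (a : ℕ → ℝ) (ha : ∀ n, 0 ≤ a n)
    (ϑ : ℝ) (hϑ0 : 0 < ϑ) (hϑ1 : ϑ ≤ 1) (g : ℕ → ℝ) (hlev : HasLevel a ϑ g)
    (α c : ℝ) (hα : 0 < α) (hαc : α < c) (hc : 2 * c < ϑ) :
    (fun x : ℝ => ∑ n ∈ (Finset.Icc 1 ⌊x⌋₊).filter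
        (fun n => ∃ p : ℕ, p.Prime ∧ x ^ α ≤ (p:ℝ) ∧ (p:ℝ) ≤ x ^ c ∧ p ^ 2 ∣ n), a n)
      =o[atTop] fun x : ℝ => N a x := by
  obtain ⟨-, hg01, -, ⟨C, hC, K, hK⟩, hdist⟩ := hlev
  obtain ⟨L, hL⟩ := hdist (2 * c) (by linarith) hc 1 one_pos
  have hsum : Summable (fun n : ℕ => 1 / (n:ℝ) ^ (3/2 : ℝ)) :=
    Real.summable_one_div_nat_rpow.mpr (by norm_num)
  set S : ℝ := ∑' n : ℕ, 1 / (n:ℝ) ^ (3/2 : ℝ) with hS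
  have hlim : Tendsto (fun x : ℝ => |K| * C ^ 2 * S * x ^ (-(α / 2)) + |L| * (Real.log x)⁻¹)
      atTop (nhds 0) := by
    have h1 := (tendsto_rpow_neg_atTop (show 0 < α / 2 by linarith)).const_mul (|K| * C ^ 2 * S)
    have h2 := (Real.tendsto_log_atTop.inv_tendsto_atTop).const_mul |L|
    simpa using h1.add h2
  rw [Asymptotics.isLittleO_iff]
  intro ε hε
  filter_upwards [hlim.eventually (gt_mem_nhds hε), eventually_ge_atTop (2:ℝ)] with x hx hx2
  have hx0 : 0 < x := by linarith
  have hlog : 0 < Real.log x := Real.log_pos (by linarith)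
  have hN : 0 ≤ N a x := Finset.sum_nonneg fun n _ => ha n
  rw [Real.norm_of_nonneg (Finset.sum_nonneg fun n _ => ha n), Real.norm_of_nonneg hN]
  refine le_trans ?_ (mul_le_mul_of_nonneg_right hx.le hN)
  set P : Finset ℕ := (Finset.Icc 1 ⌊x ^ c⌋₊).filter (fun p => p.Prime ∧ x ^ α ≤ (p:ℝ)) with hP
  have memP : ∀ p ∈ P, p.Prime ∧ x ^ α ≤ (p:ℝ) ∧ (p:ℝ) ≤ x ^ c := by
    intro p hp
    simp only [hP, Finset.mem_filter, Finset.mem_Icc] at hp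
    exact ⟨hp.2.1, hp.2.2, (Nat.le_floor_iff (by positivity)).mp hp.1.2⟩
  -- union bound
  have step1 : ∑ n ∈ (Finset.Icc 1 ⌊x⌋₊).filter
        (fun n => ∃ p : ℕ, p.Prime ∧ x ^ α ≤ (p:ℝ) ∧ (p:ℝ) ≤ x ^ c ∧ p ^ 2 ∣ n), a n
      ≤ ∑ p ∈ P, Nd a (p ^ 2) x := by
    unfold Nd
    refine le_trans (Finset.sum_le_sum_of_subset_of_nonneg (t := P.biUnion fun p =>
      (Finset.Icc 1 ⌊x⌋₊).filter (fun n => p ^ 2 ∣ n)) ?_ fun n _ _ => ha n) ?_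
    · intro n hn
      rw [Finset.mem_filter] at hn
      obtain ⟨hn, p, hp, h1, h2, h3⟩ := hn
      rw [Finset.mem_biUnion]
      refine ⟨p, ?_, Finset.mem_filter.mpr ⟨hn, h3⟩⟩
      simp only [hP, Finset.mem_filter, Finset.mem_Icc]
      exact ⟨⟨hp.one_le, Nat.le_floor h2⟩, hp, h1⟩
    · exact sum_biUnion_le_aux _ _ _ ha
  have step2 : ∑ p ∈ P, |Nd a (p ^ 2) x - g (p ^ 2) * N a x| ≤ |L| * (Real.log x)⁻¹ * N a x := by
    have e : ∑ p ∈ P, |Nd a (p ^ 2) x - g (p ^ 2) * N a x|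
        = ∑ d ∈ P.image (fun p => p ^ 2), |Nd a d x - g d * N a x| := by
      rw [Finset.sum_image]
      intro p _ q _ h
      exact Nat.pow_left_injective (n := 2) (by norm_num) h
    rw [e]
    refine (Finset.sum_le_sum_of_subset_of_nonneg ?_ fun _ _ _ => abs_nonneg _).trans
      ((hL x hx2).trans ?_)
    · intro d hd
      obtain ⟨p, hp, rfl⟩ := Finset.mem_image.mp hd
      obtain ⟨h1, h2, h3⟩ := memP p hp
      refine Finset.mem_Icc.mpr ⟨Nat.one_le_pow _ _ h1.pos, Nat.le_floor ?_⟩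
      have : x ^ (2 * c) = (x ^ c) ^ 2 := by
        rw [mul_comm, Real.rpow_mul hx0.le]; norm_num
      rw [this]
      push_cast
      gcongr
    · rw [Real.rpow_one, div_eq_mul_inv]
      have : L ≤ |L| := le_abs_self L
      calc L * N a x * (Real.log x)⁻¹ ≤ |L| * N a x * (Real.log x)⁻¹ := by gcongr
        _ = _ := by ring
  have step3 : ∑ p ∈ P, g (p ^ 2) ≤ |K| * C ^ 2 * S * x ^ (-(α / 2)) := by
    have h : ∀ p ∈ P, g (p ^ 2) ≤
        |K| * C ^ 2 * x ^ (-(α / 2)) * (1 / (p:ℝ) ^ (3/2 : ℝ)) := by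
      intro p hp
      obtain ⟨h1, h2, h3⟩ := memP p hp
      have hp0 : (0:ℝ) < p := by exact_mod_cast h1.pos
      have hom : bigOmega (p ^ 2) = 2 := by
        simp [bigOmega, h1.primeFactorsList_pow]
      have hk := hK (p ^ 2) (Nat.one_le_pow _ _ h1.pos)
      rw [hom] at hk
      have hhalf : (p:ℝ) ^ (-(1/2) : ℝ) ≤ x ^ (-(α / 2)) := by
        have := Real.rpow_le_rpow_of_nonpos (z := -(1/2)) (Real.rpow_pos_of_pos hx0 α) h2
          (by norm_num)
        rw [← Real.rpow_mul hx0.le] at this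
        convert this using 2
        ring
      have hinv : (1:ℝ) / ((p ^ 2 : ℕ) : ℝ) = (p:ℝ) ^ (-(1/2) : ℝ) * (1 / (p:ℝ) ^ (3/2 : ℝ)) := by
        rw [one_div ((p:ℝ) ^ (3/2 : ℝ)), ← Real.rpow_neg hp0.le, ← Real.rpow_add hp0]
        norm_num
      calc g (p ^ 2) ≤ K * C ^ 2 / ((p ^ 2 : ℕ) : ℝ) := hk
        _ ≤ |K| * C ^ 2 / ((p ^ 2 : ℕ) : ℝ) := by
            gcongr; exact le_abs_self K
        _ = |K| * C ^ 2 * ((p:ℝ) ^ (-(1/2) : ℝ) * (1 / (p:ℝ) ^ (3/2 : ℝ))) := by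
            rw [← hinv]; ring
        _ ≤ |K| * C ^ 2 * (x ^ (-(α / 2)) * (1 / (p:ℝ) ^ (3/2 : ℝ))) := by gcongr
        _ = _ := by ring
    refine (Finset.sum_le_sum h).trans ?_
    rw [← Finset.mul_sum]
    have hle : ∑ p ∈ P, 1 / (p:ℝ) ^ (3/2 : ℝ) ≤ S :=
      hsum.sum_le_tsum P fun n _ => by positivity
    calc _ ≤ |K| * C ^ 2 * x ^ (-(α / 2)) * S := by gcongr
      _ = _ := by ring
  calc _ ≤ ∑ p ∈ P, Nd a (p ^ 2) x := step1
    _ ≤ ∑ p ∈ P, (g (p ^ 2) * N a x + |Nd a (p ^ 2) x - g (p ^ 2) * N a x|) := by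
        refine Finset.sum_le_sum fun p _ => ?_
        have := le_abs_self (Nd a (p ^ 2) x - g (p ^ 2) * N a x)
        linarith
    _ = (∑ p ∈ P, g (p ^ 2)) * N a x + ∑ p ∈ P, |Nd a (p ^ 2) x - g (p ^ 2) * N a x| := by
        rw [Finset.sum_add_distrib, Finset.sum_mul]
    _ ≤ |K| * C ^ 2 * S * x ^ (-(α / 2)) * N a x + |L| * (Real.log x)⁻¹ * N a x := by
        gcongr
    _ = _ := by ring
end

section
/- Let g be a nonnegative real-valued function on the primes satisfying ∑_{p ≤ x, p prime} g(p) log p = log x + O(1) for all x ≥ 2. Then for any fixed real numbers 0 < α < β, ∑_{x^α ≤ q ≤ x^β, q prime} g(q) → log(β/α) as x → ∞. -/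
open Finset Filter Real

open scoped Classical

noncomputable def mwF (g : ℕ → ℝ) (x : ℝ) : ℝ :=
  ∑ p ∈ (Finset.Icc 1 ⌊x⌋₊).filter Nat.Prime, g p

noncomputable def mwS (g : ℕ → ℝ) (x : ℝ) : ℝ :=
  ∑ p ∈ (Finset.Icc 1 ⌊x⌋₊).filter Nat.Prime, g p * Real.log p

lemma mw_diff (f : ℕ → ℝ) {u v : ℝ} (h : u ≤ v) :
    mwF f v - mwF f u = ∑ p ∈ (Finset.Ioc ⌊u⌋₊ ⌊v⌋₊).filter Nat.Prime, f p := by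
  have hf : ⌊u⌋₊ ≤ ⌊v⌋₊ := Nat.floor_mono h
  unfold mwF
  rw [sub_eq_iff_eq_add, ← Finset.sum_union]
  · congr 1
    ext p
    simp only [Finset.mem_filter, Finset.mem_union, Finset.mem_Icc, Finset.mem_Ioc]
    constructor
    · rintro ⟨⟨h1, h2⟩, h3⟩
      by_cases h4 : p ≤ ⌊u⌋₊
      · exact Or.inr ⟨⟨h1, h4⟩, h3⟩
      · exact Or.inl ⟨⟨by omega, h2⟩, h3⟩
    · rintro (⟨⟨h1, h2⟩, h3⟩ | ⟨⟨h1, h2⟩, h3⟩)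
      · exact ⟨⟨h3.one_lt.le, h2⟩, h3⟩
      · exact ⟨⟨h1, by omega⟩, h3⟩
  · rw [Finset.disjoint_left]
    intro p hp hq
    simp only [Finset.mem_filter, Finset.mem_Icc, Finset.mem_Ioc] at hp hq
    omega

lemma mw_piece (g : ℕ → ℝ) (hg : ∀ p : ℕ, p.Prime → 0 ≤ g p) {u v : ℝ} (hu : 2 ≤ u) (h : u ≤ v) :
    (mwF g v - mwF g u) * Real.log u ≤ mwS g v - mwS g u ∧
    mwS g v - mwS g u ≤ (mwF g v - mwF g u) * Real.log v := by
  have hS : mwS g v - mwS g u =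
      ∑ p ∈ (Finset.Ioc ⌊u⌋₊ ⌊v⌋₊).filter Nat.Prime, g p * Real.log p :=
    mw_diff (fun p => g p * Real.log p) h
  rw [hS, mw_diff g h, Finset.sum_mul, Finset.sum_mul]
  constructor
  · apply Finset.sum_le_sum
    intro p hp
    simp only [Finset.mem_filter, Finset.mem_Ioc] at hp
    have : u < p := (Nat.floor_lt (by linarith)).1 hp.1.1
    exact mul_le_mul_of_nonneg_left (Real.log_le_log (by linarith) this.le) (hg p hp.2)
  · apply Finset.sum_le_sum
    intro p hp
    simp only [Finset.mem_filter, Finset.mem_Ioc] at hp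
    have : (p:ℝ) ≤ v := (Nat.le_floor_iff (by linarith)).1 hp.1.2
    have hp0 : (0:ℝ) < p := by exact_mod_cast hp.2.pos
    exact mul_le_mul_of_nonneg_left (Real.log_le_log hp0 this) (hg p hp.2)

lemma mw_step (g : ℕ → ℝ) (hg : ∀ p : ℕ, p.Prime → 0 ≤ g p) (M : ℝ)
    (hM : ∀ x : ℝ, 2 ≤ x → |mwS g x - Real.log x| ≤ M) {s t : ℝ} (hs : 1 ≤ s)
    (ht : 0 ≤ t) (ht1 : t ≤ 1) :
    |mwF g (exp (s * exp t)) - mwF g (exp s) - t| ≤ t ^ 2 + 2 * M / s := by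
  have hs0 : 0 < s := by linarith
  have hr : 1 ≤ exp t := Real.one_le_exp ht
  have hss : s ≤ s * exp t := by nlinarith
  have h2 : 2 ≤ exp s := by linarith [Real.add_one_le_exp s]
  have huv : exp s ≤ exp (s * exp t) := Real.exp_le_exp.2 hss
  obtain ⟨h3, h4⟩ := mw_piece g hg h2 huv
  have h5 := hM _ h2
  have h6 := hM _ (h2.trans huv)
  have hM0 : 0 ≤ M := (abs_nonneg _).trans h5
  rw [Real.log_exp] at h3 h4 h5 h6
  rw [abs_le] at h5 h6
  set D := mwF g (exp (s * exp t)) - mwF g (exp s)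
  have e1 : D ≤ exp t - 1 + 2 * M / s := by
    have : D ≤ ((exp t - 1) * s + 2 * M) / s := by
      rw [le_div_iff₀ hs0]; nlinarith
    rwa [add_div, mul_div_cancel_right₀ _ hs0.ne'] at this
  have e2 : 1 - exp (-t) - 2 * M / s ≤ D := by
    have hp : 0 < s * exp t := by positivity
    have : (s * exp t - s - 2 * M) / (s * exp t) ≤ D := by
      rw [div_le_iff₀ hp]; linarith
    have e3 : (s * exp t - s - 2 * M) / (s * exp t) = 1 - exp (-t) - 2 * M / (s * exp t) := by
      rw [Real.exp_neg]; field_simp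
    have e4 : 2 * M / (s * exp t) ≤ 2 * M / s :=
      div_le_div_of_nonneg_left (by linarith) hs0 hss
    linarith
  have q1 := Real.abs_exp_sub_one_sub_id_le (x := t) (by rw [abs_le]; constructor <;> linarith)
  have q2 := Real.abs_exp_sub_one_sub_id_le (x := -t) (by rw [abs_le]; constructor <;> linarith)
  rw [abs_le] at q1 q2 ⊢
  rw [neg_sq] at q2
  constructor <;> linarith [q1.2, q2.2]

lemma mw_steps (g : ℕ → ℝ) (hg : ∀ p : ℕ, p.Prime → 0 ≤ g p) (M : ℝ)
    (hM : ∀ x : ℝ, 2 ≤ x → |mwS g x - Real.log x| ≤ M) {s t : ℝ} (hs : 1 ≤ s)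
    (ht : 0 ≤ t) (ht1 : t ≤ 1) (k : ℕ) :
    |mwF g (exp (s * exp (k * t))) - mwF g (exp s) - k * t| ≤ k * (t ^ 2 + 2 * M / s) := by
  have hM0 : 0 ≤ M := (abs_nonneg _).trans (hM 2 le_rfl)
  induction k with
  | zero => simp
  | succ k ih =>
    have hr : 1 ≤ exp (k * t) := Real.one_le_exp (by positivity)
    have hss : s ≤ s * exp (k * t) := by nlinarith
    have h := mw_step g hg M hM (hs.trans hss) ht ht1
    have e4 : 2 * M / (s * exp (k * t)) ≤ 2 * M / s :=
      div_le_div_of_nonneg_left (by linarith) (by linarith) hss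
    rw [mul_assoc, ← Real.exp_add] at h
    have e5 : ((k + 1 : ℕ) : ℝ) * t = k * t + t := by push_cast; ring
    rw [e5]
    push_cast
    rw [abs_le] at h ih ⊢
    constructor <;> linarith [h.1, h.2, ih.1, ih.2]

lemma mw_tendsto (g : ℕ → ℝ) (hg : ∀ p : ℕ, p.Prime → 0 ≤ g p) (M : ℝ)
    (hM : ∀ x : ℝ, 2 ≤ x → |mwS g x - Real.log x| ≤ M) (L : ℝ) (hL : 0 ≤ L) :
    Tendsto (fun s : ℝ => mwF g (exp (s * exp L)) - mwF g (exp s)) atTop (nhds L) := by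
  rw [Metric.tendsto_nhds]
  intro ε hε
  obtain ⟨k, hk⟩ := exists_nat_gt (max 1 (max L (L ^ 2 / (ε / 2))))
  have hk1 : (1:ℝ) < k := (le_max_left _ _).trans_lt hk
  have hkL : L < k := ((le_max_left _ _).trans (le_max_right _ _)).trans_lt hk
  have hkL2 : L ^ 2 / (ε / 2) < k := ((le_max_right _ _).trans (le_max_right _ _)).trans_lt hk
  have hk0 : (0:ℝ) < k := by linarith
  have hlim : Tendsto (fun s : ℝ => k * (2 * M / s)) atTop (nhds (k * 0)) :=
    (tendsto_const_nhds.div_atTop tendsto_id).const_mul _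
  rw [mul_zero] at hlim
  filter_upwards [hlim.eventually_lt_const (half_pos hε), eventually_ge_atTop 1] with s h1 h2
  have h := mw_steps g hg M hM h2 (t := L / k) (by positivity)
    (by rw [div_le_one hk0]; exact hkL.le) k
  rw [mul_div_cancel₀ _ hk0.ne'] at h
  rw [Real.dist_eq]
  refine h.trans_lt ?_
  have : k * (L / k) ^ 2 < ε / 2 := by
    have : k * (L / k) ^ 2 = L ^ 2 / k := by field_simp
    rw [this, div_lt_iff₀ hk0]
    rw [div_lt_iff₀ (by positivity)] at hkL2
    linarith
  linarith

lemma mw_tendsto' (g : ℕ → ℝ) (hg : ∀ p : ℕ, p.Prime → 0 ≤ g p) (M : ℝ)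
    (hM : ∀ x : ℝ, 2 ≤ x → |mwS g x - Real.log x| ≤ M) (α β : ℝ) (hα : 0 < α) (hαβ : α < β) :
    Tendsto (fun x : ℝ => mwF g (x ^ β) - mwF g (x ^ α)) atTop (nhds (Real.log (β / α))) := by
  have h1 : 1 ≤ β / α := by rw [one_le_div hα]; exact hαβ.le
  have h := (mw_tendsto g hg M hM (Real.log (β / α)) (Real.log_nonneg h1)).comp
    (Real.tendsto_log_atTop.atTop_mul_const hα)
  refine h.congr' ?_
  filter_upwards [eventually_gt_atTop 0] with x hx
  simp only [Function.comp]
  rw [Real.exp_log (by linarith), Real.rpow_def_of_pos hx, Real.rpow_def_of_pos hx, mul_assoc,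
    mul_div_cancel₀ _ hα.ne']

/-- a Mertens-type hypothesis `∑_{p ≤ x} g(p) log p = log x + O(1)`
implies `∑_{x^α ≤ q ≤ x^β} g(q) → log(β/α)` for fixed `0 < α < β`. -/
theorem mertens_window (g : ℕ → ℝ) (hg : ∀ p : ℕ, p.Prime → 0 ≤ g p)
    (hM : ∃ M : ℝ, ∀ x : ℝ, 2 ≤ x →
      |(∑ p ∈ (Finset.Icc 1 ⌊x⌋₊).filter Nat.Prime, g p * Real.log p) - Real.log x| ≤ M)
    (α β : ℝ) (hα : 0 < α) (hαβ : α < β) :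
    Tendsto (fun x : ℝ =>
        ∑ q ∈ (Finset.Icc 1 ⌊x ^ β⌋₊).filter (fun q : ℕ => q.Prime ∧ x ^ α ≤ (q:ℝ)), g q)
      atTop (nhds (Real.log (β / α))) := by
  obtain ⟨M, hM⟩ := hM
  have hM' : ∀ x : ℝ, 2 ≤ x → |mwS g x - Real.log x| ≤ M := hM
  have hlow := mw_tendsto' g hg M hM' α β hα hαβ
  rw [tendsto_order]
  constructor
  · intro a ha
    filter_upwards [hlow.eventually_const_lt ha, eventually_gt_atTop 1] with x h1 hx
    refine h1.trans_le ?_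
    have hle : x ^ α ≤ x ^ β := Real.rpow_le_rpow_of_exponent_le hx.le hαβ.le
    rw [mw_diff g hle]
    apply Finset.sum_le_sum_of_subset_of_nonneg
    · intro p hp
      simp only [Finset.mem_filter, Finset.mem_Ioc, Finset.mem_Icc] at hp ⊢
      exact ⟨⟨hp.2.one_lt.le, hp.1.2⟩, hp.2,
        ((Nat.floor_lt (by positivity)).1 hp.1.1).le⟩
    · intro p hp _
      simp only [Finset.mem_filter] at hp
      exact hg p hp.2.1
  · intro a ha
    obtain ⟨δ, hδ, hδα, hδa⟩ : ∃ δ : ℝ, 0 < δ ∧ δ < α ∧ Real.log (β / δ) < a := by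
      have hc : Tendsto (fun δ : ℝ => Real.log (β / δ)) (nhdsWithin α (Set.Iio α))
          (nhds (Real.log (β / α))) := by
        have : ContinuousAt (fun δ : ℝ => Real.log (β / δ)) α := by
          apply ContinuousAt.log
          · exact continuousAt_const.div continuousAt_id hα.ne'
          · exact (div_pos (hα.trans hαβ) hα).ne'
        exact this.tendsto.mono_left nhdsWithin_le_nhds
      obtain ⟨δ, h1, h2, h3⟩ := ((hc.eventually_lt_const ha).and
        ((Ioo_mem_nhdsLT hα : Set.Ioo 0 α ∈ nhdsWithin α (Set.Iio α)))).exists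
      exact ⟨δ, h2, h3, h1⟩
    have hup := mw_tendsto' g hg M hM' δ β hδ (hδα.trans hαβ)
    filter_upwards [hup.eventually_lt_const hδa, eventually_gt_atTop 1] with x h1 hx
    refine lt_of_le_of_lt ?_ h1
    have hle : x ^ δ ≤ x ^ β := Real.rpow_le_rpow_of_exponent_le hx.le (hδα.trans hαβ).le
    have hlt : x ^ δ < x ^ α := Real.rpow_lt_rpow_of_exponent_lt hx hδα
    rw [mw_diff g hle]
    apply Finset.sum_le_sum_of_subset_of_nonneg
    · intro p hp
      simp only [Finset.mem_filter, Finset.mem_Ioc, Finset.mem_Icc] at hp ⊢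
      exact ⟨⟨(Nat.floor_lt (by positivity)).2 (hlt.trans_le hp.2.2), hp.1.2⟩, hp.2.1⟩
    · intro p hp _
      simp only [Finset.mem_filter] at hp
      exact hg p hp.2
end

section
/- Let F ∈ ℤ[X] be a polynomial of degree D ≥ 1 which is irreducible over ℚ. For a positive integer d, let h(d) be the number of residues r modulo d with F(r) ≡ 0 (mod d). Then there exists a constant C ≥ 1 (depending only on F; any C greater than max(D, p_1, …, p_ℓ) works, where p_1, …, p_ℓ are the prime divisors of the discriminant of F) such that h(d) ≤ C^{Ω(d)} for all d ≥ 1. -/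
open Finset Filter Real

open scoped Classical

open Polynomial in
theorem exists_bezout_int (F : Polynomial ℤ)
    (hirr : Irreducible (F.map (algebraMap ℤ ℚ))) :
    ∃ (A B : Polynomial ℤ) (R : ℤ), R ≠ 0 ∧ A * F + B * derivative F = C R := by
  obtain ⟨a, b, hab⟩ := hirr.separable
  obtain ⟨s, hs⟩ := IsLocalization.integerNormalization_map_to_map (nonZeroDivisors ℤ) a
  obtain ⟨t, ht⟩ := IsLocalization.integerNormalization_map_to_map (nonZeroDivisors ℤ) b
  refine ⟨C (t:ℤ) * IsLocalization.integerNormalization (nonZeroDivisors ℤ) a,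
    C (s:ℤ) * IsLocalization.integerNormalization (nonZeroDivisors ℤ) b, (s:ℤ) * t,
    mul_ne_zero (nonZeroDivisors.coe_ne_zero s) (nonZeroDivisors.coe_ne_zero t), ?_⟩
  apply Polynomial.map_injective (algebraMap ℤ ℚ) (algebraMap ℤ ℚ).injective_int
  simp only [Polynomial.map_add, Polynomial.map_mul, Polynomial.map_C, map_mul, hs, ht]
  rw [Polynomial.derivative_map] at hab
  have e1 : (s:ℤ) • a = C (algebraMap ℤ ℚ s) * a := by
    rw [← Polynomial.smul_eq_C_mul, algebraMap_smul]
  have e2 : (t:ℤ) • b = C (algebraMap ℤ ℚ t) * b := by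
    rw [← Polynomial.smul_eq_C_mul, algebraMap_smul]
  rw [e1, e2]
  linear_combination (C (algebraMap ℤ ℚ s) * C (algebraMap ℤ ℚ t)) * hab

theorem fiber_trivial (S : Finset ℕ) (p d r : ℕ) (hd : 1 ≤ d)
    (hS : ∀ x ∈ S, x < p * d ∧ x % d = r) : S.card ≤ p := by
  have : S.card ≤ (Finset.range p).card := by
    apply Finset.card_le_card_of_injOn (fun x => x / d)
    · intro x hx
      simp only [Finset.coe_range, Set.mem_Iio]
      exact Nat.div_lt_of_lt_mul (by rw [mul_comm]; exact (hS x hx).1)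
    · intro x hx y hy hxy
      have h1 := Nat.div_add_mod x d
      have h2 := Nat.div_add_mod y d
      simp only at hxy
      rw [(hS x hx).2, hxy] at h1
      rw [(hS y hy).2] at h2
      omega
  simpa using this

theorem fiber_coprime (F : Polynomial ℤ) (S : Finset ℕ) (p d r : ℕ) (hp : p.Prime)
    (hpd : ¬ p ∣ d) (hF : F.map (Int.castRingHom (ZMod p)) ≠ 0)
    (hS : ∀ x ∈ S, x < p * d ∧ x % d = r ∧ (p:ℤ) ∣ F.eval (x:ℤ)) : S.card ≤ F.natDegree := by
  haveI := Fact.mk hp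
  have : S.card ≤ (F.map (Int.castRingHom (ZMod p))).roots.toFinset.card := by
    apply Finset.card_le_card_of_injOn (fun x : ℕ => (x : ZMod p))
    · intro x hx
      have h := (ZMod.intCast_zmod_eq_zero_iff_dvd _ p).2 (hS x hx).2.2
      simp only [Finset.mem_coe, Multiset.mem_toFinset]
      rw [Polynomial.mem_roots hF, Polynomial.IsRoot]
      have := Polynomial.eval_intCast_map (Int.castRingHom (ZMod p)) F (x:ℤ)
      simp only [Int.cast_natCast, eq_intCast] at this
      rw [this]; exact h
    · intro x hx y hy hxy
      have h1 : x ≡ y [MOD p] := (ZMod.natCast_eq_natCast_iff _ _ _).1 hxy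
      have h2 : x ≡ y [MOD d] := by
        rw [Nat.ModEq, (hS x hx).2.1, (hS y hy).2.1]
      have h3 := (Nat.modEq_and_modEq_iff_modEq_mul ((Nat.Prime.coprime_iff_not_dvd hp).2 hpd)).1 ⟨h1, h2⟩
      exact h3.eq_of_lt_of_lt (hS x hx).1 (hS y hy).1
  refine this.trans ((Multiset.toFinset_card_le _).trans ((Polynomial.card_roots' _).trans ?_))
  exact Polynomial.natDegree_map_le

open Polynomial in
theorem fiber_dvd (F : Polynomial ℤ) (S : Finset ℕ) (p d r : ℕ) (hp : p.Prime) (hd : 1 ≤ d)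
    (hpd : p ∣ d) (hF : ∀ x : ℤ, (p:ℤ) ∣ F.eval x → ¬ (p:ℤ) ∣ (derivative F).eval x)
    (hS : ∀ x ∈ S, x < p * d ∧ x % d = r ∧ ((p*d : ℕ):ℤ) ∣ F.eval (x:ℤ)) : S.card ≤ 1 := by
  rw [Finset.card_le_one]
  intro x hx y hy
  obtain ⟨hx1, hx2, hx3⟩ := hS x hx
  obtain ⟨hy1, hy2, hy3⟩ := hS y hy
  have h2 : x ≡ y [MOD d] := by rw [Nat.ModEq, hx2, hy2]
  obtain ⟨t, ht⟩ := h2.dvd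
  obtain ⟨k, hk⟩ := F.binomExpansion (x:ℤ) (d * t)
  rw [← ht, add_sub_cancel, ht] at hk
  have hpi : Prime (p:ℤ) := Nat.prime_iff_prime_int.1 hp
  push_cast at hx3 hy3
  obtain ⟨e, he⟩ := hpd
  have h4 : ((p:ℤ) * d) ∣ (d:ℤ) * ((derivative F).eval (x:ℤ) * t) := by
    have : (d:ℤ) * ((derivative F).eval (x:ℤ) * t)
      = F.eval (y:ℤ) - F.eval (x:ℤ) - (p * d) * (k * e * t^2) := by
      rw [hk]
      have : (d:ℤ) = p * e := by exact_mod_cast he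
      linear_combination (-(k * t^2 * d : ℤ)) * this
    rw [this]
    exact dvd_sub (dvd_sub hy3 hx3) (dvd_mul_right _ _)
  rw [mul_comm (p:ℤ)] at h4
  have h5 := (mul_dvd_mul_iff_left (by positivity : (d:ℤ) ≠ 0)).1 h4
  rcases hpi.dvd_or_dvd h5 with h | h
  · exact absurd h (hF _ ((dvd_mul_right _ _).trans hx3))
  · have h6 : x ≡ y [MOD (p*d)] := by
      rw [Nat.modEq_iff_dvd, ht]
      push_cast
      rw [mul_comm]
      exact mul_dvd_mul_left _ h
    exact h6.eq_of_lt_of_lt hx1 hy1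

/-- for an irreducible polynomial `F` of degree `D ≥ 1`, there is a
constant `C ≥ 1` with `h(d) ≤ C^{Ω(d)}` for all `d ≥ 1`, where `h(d)` is the number of
roots of `F` modulo `d`. -/
theorem rootCount_bound (F : Polynomial ℤ) (hdeg : 1 ≤ F.natDegree)
    (hirr : Irreducible (F.map (algebraMap ℤ ℚ))) :
    ∃ C : ℝ, 1 ≤ C ∧ ∀ d : ℕ, 1 ≤ d → (rootCount F d : ℝ) ≤ C ^ bigOmega d := by
  obtain ⟨A, B, R, hR, hAB⟩ := exists_bezout_int F hirr
  set M : ℕ := max F.natDegree R.natAbs with hM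
  have hMD : F.natDegree ≤ M := le_max_left _ _
  have hMR : R.natAbs ≤ M := le_max_right _ _
  refine ⟨(M:ℝ), by exact_mod_cast hdeg.trans hMD, ?_⟩
  suffices H : ∀ d : ℕ, 1 ≤ d → rootCount F d ≤ M ^ bigOmega d by
    intro d hd; exact_mod_cast H d hd
  intro d
  induction d using induction_on_primes with
  | zero => intro h; omega
  | one =>
    intro _
    refine (Finset.card_filter_le _ _).trans ?_
    simp [bigOmega]
  | prime_mul p d hp ih =>
    intro hpd
    have hd : 1 ≤ d := by
      rcases Nat.eq_zero_or_pos d with h | h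
      · simp [h] at hpd
      · exact h
    have hO : bigOmega (p * d) = bigOmega d + 1 := by
      have := (Nat.perm_primeFactorsList_mul hp.ne_zero (by omega : d ≠ 0)).length_eq
      unfold bigOmega
      rw [this, List.length_append, Nat.primeFactorsList_prime hp]
      simp [add_comm]
    rw [hO, pow_succ']
    refine le_trans ?_ (Nat.mul_le_mul_left M (ih hd))
    unfold rootCount
    refine Finset.card_le_mul_card_image_of_maps_to (f := fun x => x % d) ?_ M ?_
    · intro x hx
      simp only [Finset.mem_filter, Finset.mem_range] at hx ⊢
      refine ⟨Nat.mod_lt _ hd, ?_⟩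
      have h1 : (d:ℤ) ∣ F.eval (x:ℤ) := by
        refine dvd_trans ?_ hx.2
        push_cast; exact dvd_mul_left _ _
      have h2 : (d:ℤ) ∣ (x:ℤ) - ((x % d : ℕ):ℤ) :=
        (Nat.modEq_iff_dvd.1 (Nat.mod_modEq x d))
      have h3 := h2.trans (Polynomial.sub_dvd_eval_sub (x:ℤ) ((x % d : ℕ):ℤ) F)
      exact (dvd_sub_right h1).1 h3
    · intro r _
      have hS : ∀ x ∈ {a ∈ {r ∈ range (p * d) | ((p * d : ℕ):ℤ) ∣ F.eval (r:ℤ)} | a % d = r},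
          x < p * d ∧ x % d = r ∧ ((p*d : ℕ):ℤ) ∣ F.eval (x:ℤ) := by
        intro x hx
        simp only [Finset.mem_filter, Finset.mem_range] at hx
        exact ⟨hx.1.1, hx.2, hx.1.2⟩
      by_cases hpR : (p:ℤ) ∣ R
      · refine (fiber_trivial _ p d r hd fun x hx => ⟨(hS x hx).1, (hS x hx).2.1⟩).trans ?_
        exact (Nat.le_of_dvd (Int.natAbs_pos.2 hR) (Int.natCast_dvd.1 hpR)).trans hMR
      · by_cases hpd' : p ∣ d
        · refine (fiber_dvd F _ p d r hp hd hpd' ?_ hS).trans (hdeg.trans hMD)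
          intro x h1 h2
          apply hpR
          have := congrArg (Polynomial.eval x) hAB
          simp only [Polynomial.eval_add, Polynomial.eval_mul, Polynomial.eval_C] at this
          rw [← this]
          exact dvd_add (h1.mul_left _) (h2.mul_left _)
        · refine (fiber_coprime F _ p d r hp hpd' ?_ fun x hx =>
            ⟨(hS x hx).1, (hS x hx).2.1, dvd_trans ?_ (hS x hx).2.2⟩).trans hMD
          · intro h0
            apply hpR
            have := congrArg (Polynomial.map (Int.castRingHom (ZMod p))) hAB
            simp only [Polynomial.map_add, Polynomial.map_mul, ← Polynomial.derivative_map, h0,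
              Polynomial.derivative_zero, mul_zero, add_zero, Polynomial.map_C] at this
            have h := (Polynomial.C_eq_zero.1 this.symm)
            exact (ZMod.intCast_zmod_eq_zero_iff_dvd _ p).1 (by simpa using h)
          · push_cast; exact dvd_mul_right _ _
end

section
/- Let F ∈ ℤ[X] be a polynomial of degree D ≥ 1, irreducible over ℚ, with positive leading coefficient. For x ≥ 1 and d ≥ 1, define N(x) = #{ n ≥ 1 : 0 < F(n) ≤ x } and N_d(x) = #{ n ≥ 1 : 0 < F(n) ≤ x and d ∣ F(n) }, and let h(d) be the number of residues r modulo d with F(r) ≡ 0 (mod d). Then |N_d(x) − (h(d)/d)·N(x)| ≪_F h(d), uniformly for all x ≥ 1 and all d ≥ 1, where the implied constant depends only on F. -/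
open Finset Filter Real

open scoped Classical

/-- `NF F x = #{n ≥ 1 : 0 < F(n) ≤ x}`. -/
noncomputable def NF (F : Polynomial ℤ) (x : ℝ) : ℕ :=
  Set.ncard {n : ℕ | 1 ≤ n ∧ 0 < F.eval (n:ℤ) ∧ ((F.eval (n:ℤ) : ℤ) : ℝ) ≤ x}

/-- `NFd F d x = #{n ≥ 1 : 0 < F(n) ≤ x, d ∣ F(n)}`. -/
noncomputable def NFd (F : Polynomial ℤ) (d : ℕ) (x : ℝ) : ℕ :=
  Set.ncard {n : ℕ | 1 ≤ n ∧ 0 < F.eval (n:ℤ) ∧ ((F.eval (n:ℤ) : ℤ) : ℝ) ≤ x ∧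
    (d:ℤ) ∣ F.eval (n:ℤ)}

theorem count_periodic_aux (p : ℕ → Prop) [DecidablePred p] (d : ℕ) (hp : ∀ k, p (d + k) ↔ p k)
    (q r : ℕ) : Nat.count p (d * q + r) = q * Nat.count p d + Nat.count p r := by
  induction q with
  | zero => simp
  | succ q ih =>
    have h : d * (q + 1) + r = d + (d * q + r) := by ring
    rw [h, Nat.count_add]
    simp only [hp]
    rw [ih]
    ring

theorem count_periodic_bound (p : ℕ → Prop) [DecidablePred p] (d : ℕ) (hd : 1 ≤ d)
    (hp : ∀ k, p (d + k) ↔ p k) (y : ℕ) :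
    |(Nat.count p y : ℝ) - (Nat.count p d : ℝ) / d * y| ≤ Nat.count p d := by
  have h := count_periodic_aux p d hp (y / d) (y % d)
  have hy := Nat.div_add_mod y d
  rw [hy] at h
  have hr : y % d ≤ d := (Nat.mod_lt y hd).le
  have hc : Nat.count p (y % d) ≤ Nat.count p d := Nat.count_monotone p hr
  have hd' : (0:ℝ) < d := by exact_mod_cast hd
  have hyR : (y:ℝ) = d * (y / d : ℕ) + (y % d : ℕ) := by exact_mod_cast hy.symm
  have hhR : (Nat.count p y : ℝ) = (y / d : ℕ) * Nat.count p d + Nat.count p (y % d) := by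
    exact_mod_cast h
  have hcR : (Nat.count p (y % d) : ℝ) ≤ Nat.count p d := by exact_mod_cast hc
  have hrR : ((y % d : ℕ) : ℝ) ≤ d := by exact_mod_cast hr
  rw [hhR, hyR]
  generalize (y / d : ℕ) = q at *
  generalize (y % d : ℕ) = r at *
  have e : (Nat.count p d : ℝ) / d * (d * q + r) = q * Nat.count p d + Nat.count p d * (r / d) := by
    field_simp
  rw [e]
  have h1 : (r:ℝ) / d ≤ 1 := (div_le_one hd').2 hrR
  have h0 : (0:ℝ) ≤ (r:ℝ) / d := by positivity
  have h2 : (Nat.count p d : ℝ) * (r / d) ≤ Nat.count p d :=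
    mul_le_of_le_one_right (by positivity) h1
  have h3 : 0 ≤ (Nat.count p d : ℝ) * (r / d) := by positivity
  have h4 : (0:ℝ) ≤ Nat.count p r := by positivity
  rw [abs_le]
  constructor <;> linarith

theorem poly_eventually_mono (F : Polynomial ℤ) (hdeg : 1 ≤ F.natDegree)
    (hlead : 0 < F.leadingCoeff) :
    ∃ M : ℕ, 1 ≤ M ∧ (∀ n : ℕ, M ≤ n → 0 < F.eval (n:ℤ)) ∧
      (∀ m n : ℕ, M ≤ m → m ≤ n → F.eval (m:ℤ) ≤ F.eval (n:ℤ)) ∧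
      (∀ x : ℝ, ∃ n : ℕ, M ≤ n ∧ x < ((F.eval (n:ℤ) : ℤ) : ℝ)) := by
  set P : Polynomial ℝ := F.map (Int.castRingHom ℝ) with hP
  have hinj : Function.Injective (Int.castRingHom ℝ) := Int.cast_injective
  have hPd : P.natDegree = F.natDegree := Polynomial.natDegree_map_eq_of_injective hinj F
  have hPl : P.leadingCoeff = F.leadingCoeff := by
    rw [hP, Polynomial.leadingCoeff_map_of_injective hinj]; simp
  have hPl0 : 0 < P.leadingCoeff := by rw [hPl]; exact_mod_cast hlead
  have hev : ∀ n : ℕ, P.eval (n:ℝ) = ((F.eval (n:ℤ) : ℤ) : ℝ) := by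
    intro n
    have := Polynomial.eval_intCast_map (Int.castRingHom ℝ) F (n:ℤ)
    rw [Int.cast_natCast] at this
    simpa only [eq_intCast, Int.cast_id] using this
  have ht : Tendsto (fun x => P.eval x) atTop atTop :=
    P.tendsto_atTop_of_leadingCoeff_nonneg
      (Polynomial.natDegree_pos_iff_degree_pos.1 (by omega)) hPl0.le
  have hQl : 0 ≤ P.derivative.leadingCoeff := by
    rw [Polynomial.leadingCoeff_derivative]; positivity
  have hQ : ∀ᶠ x in atTop, 0 ≤ P.derivative.eval x := by
    by_cases h : 0 < P.derivative.degree
    · exact (P.derivative.tendsto_atTop_of_leadingCoeff_nonneg h hQl).eventually_ge_atTop 0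
    · have hc := Polynomial.eq_C_of_degree_le_zero (not_lt.1 h)
      rw [hc, Polynomial.leadingCoeff_C] at hQl
      rw [hc]
      exact Eventually.of_forall fun x => by simpa using hQl
  obtain ⟨A, hA⟩ := eventually_atTop.1 (hQ.and (ht.eventually_gt_atTop 0))
  have hmono : MonotoneOn (fun x => P.eval x) (Set.Ici A) := by
    apply monotoneOn_of_deriv_nonneg (convex_Ici A) P.continuous.continuousOn
      P.differentiable.differentiableOn
    intro x hx
    rw [interior_Ici] at hx
    rw [Polynomial.deriv]
    exact (hA x (le_of_lt hx)).1
  obtain ⟨M, hM⟩ := exists_nat_ge A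
  have hge : ∀ n : ℕ, M + 1 ≤ n → A ≤ n := by
    intro n hn
    have : (M:ℝ) ≤ n := by exact_mod_cast (by omega : M ≤ n)
    linarith
  refine ⟨M + 1, by omega, ?_, ?_, ?_⟩
  · intro n hn
    have := (hA n (hge n hn)).2
    rw [hev] at this
    exact_mod_cast this
  · intro m n hm hmn
    have := hmono (hge m hm) (hge n (hm.trans hmn)) (by exact_mod_cast hmn : (m:ℝ) ≤ n)
    simp only [hev] at this
    exact_mod_cast this
  · intro x
    have h := (ht.comp tendsto_natCast_atTop_atTop).eventually_gt_atTop x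
    obtain ⟨n, h1, h2⟩ := (h.and (eventually_ge_atTop (M+1))).exists
    exact ⟨n, h2, by simpa [hev] using h1⟩

/-- for an irreducible polynomial `F` of degree `D ≥ 1` with positive
leading coefficient, `|N_d(x) − (h(d)/d) N(x)| ≪_F h(d)` uniformly in `x ≥ 1`, `d ≥ 1`. -/
theorem poly_counting_error (F : Polynomial ℤ) (hdeg : 1 ≤ F.natDegree)
    (hirr : Irreducible (F.map (algebraMap ℤ ℚ))) (hlead : 0 < F.leadingCoeff) :
    ∃ K : ℝ, ∀ x : ℝ, 1 ≤ x → ∀ d : ℕ, 1 ≤ d →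
      |(NFd F d x : ℝ) - ((rootCount F d : ℝ) / d) * (NF F x : ℝ)| ≤
        K * (rootCount F d : ℝ) := by
  obtain ⟨M, hM1, hpos, hmono, hunb⟩ := poly_eventually_mono F hdeg hlead
  refine ⟨2 * M + 3, fun x _ d hd => ?_⟩
  set p : ℕ → Prop := fun n => (d:ℤ) ∣ F.eval (n:ℤ) with hp
  have hper : ∀ k, p (d + k) ↔ p k := by
    intro k
    have h := Polynomial.sub_dvd_eval_sub ((d + k : ℕ) : ℤ) (k:ℤ) F
    have e : ((d + k : ℕ) : ℤ) - (k:ℤ) = d := by push_cast; ring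
    rw [e] at h
    exact (dvd_iff_dvd_of_dvd_sub h)
  have hroot : rootCount F d = Nat.count p d := by
    rw [Nat.count_eq_card_filter_range, rootCount]

  set y := Nat.find (hunb x) with hy
  obtain ⟨hMy, hxy⟩ := Nat.find_spec (hunb x)
  rw [← hy] at hMy hxy
  have hlt : ∀ n, M ≤ n → (((F.eval (n:ℤ) : ℤ) : ℝ) ≤ x ↔ n < y) := by
    intro n hn
    constructor
    · intro h
      by_contra hc
      have h1 : ((F.eval (y:ℤ) : ℤ) : ℝ) ≤ ((F.eval (n:ℤ) : ℤ) : ℝ) := by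
        exact_mod_cast hmono y n hMy (not_lt.1 hc)
      linarith
    · intro h
      have := Nat.find_min (hunb x) h
      push Not at this
      exact this hn
  set A : Finset ℕ := (Finset.range M).filter
    (fun n => 1 ≤ n ∧ 0 < F.eval (n:ℤ) ∧ ((F.eval (n:ℤ) : ℤ) : ℝ) ≤ x) with hA
  have hmem : ∀ n : ℕ, (1 ≤ n ∧ 0 < F.eval (n:ℤ) ∧ ((F.eval (n:ℤ) : ℤ) : ℝ) ≤ x) ↔
      n ∈ A ∪ Finset.Ico M y := by
    intro n
    rw [Finset.mem_union, hA, Finset.mem_filter, Finset.mem_range, Finset.mem_Ico]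
    by_cases hn : n < M
    · have : ¬ M ≤ n := by omega
      simp [hn, this]
    · have hn' : M ≤ n := by omega
      have h1 : 1 ≤ n := by omega
      simp [hn, hn', h1, hpos n hn', hlt n hn']
  have hdisj : Disjoint A (Finset.Ico M y) := by
    rw [Finset.disjoint_left]
    intro n hn hn2
    rw [hA, Finset.mem_filter, Finset.mem_range] at hn
    rw [Finset.mem_Ico] at hn2
    omega
  have hN : NF F x = A.card + (y - M) := by
    have : {n : ℕ | 1 ≤ n ∧ 0 < F.eval (n:ℤ) ∧ ((F.eval (n:ℤ) : ℤ) : ℝ) ≤ x} =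
        ((A ∪ Finset.Ico M y : Finset ℕ) : Set ℕ) := by
      ext n
      exact hmem n
    rw [NF, this, Set.ncard_coe_finset, Finset.card_union_of_disjoint hdisj, Nat.card_Ico]
  have hNd : NFd F d x = (A.filter p).card + ((Finset.Ico M y).filter p).card := by
    have : {n : ℕ | 1 ≤ n ∧ 0 < F.eval (n:ℤ) ∧ ((F.eval (n:ℤ) : ℤ) : ℝ) ≤ x ∧
        (d:ℤ) ∣ F.eval (n:ℤ)} = (((A ∪ Finset.Ico M y).filter p : Finset ℕ) : Set ℕ) := by
      ext n
      rw [Finset.mem_coe, Finset.mem_filter, ← hmem n]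
      simp only [Set.mem_ofPred_eq, hp, and_assoc]
    rw [NFd, this, Set.ncard_coe_finset, Finset.filter_union, Finset.card_union_of_disjoint
      (Finset.disjoint_filter_filter hdisj)]
  have hIco : ((Finset.Ico M y).filter p).card + Nat.count p M = Nat.count p y := by
    rw [Nat.count_eq_card_filter_range, Nat.count_eq_card_filter_range, add_comm,
      ← Finset.card_union_of_disjoint, ← Finset.filter_union]
    · congr 2
      ext n
      simp only [Finset.mem_union, Finset.mem_range, Finset.mem_Ico]
      omega
    · apply Finset.disjoint_filter_filter
      rw [Finset.disjoint_left]
      intro n h1 h2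
      rw [Finset.mem_range] at h1
      rw [Finset.mem_Ico] at h2
      omega
  have hAc : A.card ≤ M := by
    simpa using Finset.card_filter_le (Finset.range M)
      (fun n => 1 ≤ n ∧ 0 < F.eval (n:ℤ) ∧ ((F.eval (n:ℤ) : ℤ) : ℝ) ≤ x)
  have hAd : (A.filter p).card ≤ Nat.count p M := by
    rw [Nat.count_eq_card_filter_range]
    exact Finset.card_le_card (Finset.filter_subset_filter _ (Finset.filter_subset _ _))
  have by1 := abs_le.1 (count_periodic_bound p d hd hper y)
  have bM := abs_le.1 (count_periodic_bound p d hd hper M)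
  rw [hN, hNd, hroot]
  have hIcoR : (((Finset.Ico M y).filter p).card : ℝ) = Nat.count p y - Nat.count p M := by
    rw [← hIco]; push_cast; ring
  have hAcR : (A.card : ℝ) ≤ M := by exact_mod_cast hAc
  have hAdR : ((A.filter p).card : ℝ) ≤ Nat.count p M := by exact_mod_cast hAd
  have hAd0 : (0:ℝ) ≤ (A.filter p).card := Nat.cast_nonneg _
  have hA0 : (0:ℝ) ≤ A.card := Nat.cast_nonneg _
  have hd' : (1:ℝ) ≤ d := by exact_mod_cast hd
  push_cast [Nat.cast_sub hMy]
  rw [hIcoR]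
  have hh0 : (0:ℝ) ≤ Nat.count p d := by positivity
  have hg : (Nat.count p d : ℝ) / d ≤ Nat.count p d := div_le_self hh0 hd'
  have hg0 : (0:ℝ) ≤ (Nat.count p d : ℝ) / d := by positivity
  generalize (Nat.count p d : ℝ) / d = g at *
  generalize (Nat.count p d : ℝ) = h at *
  have e1 : g * A.card ≤ h * M := mul_le_mul hg hAcR hA0 hh0
  have e2 : g * M ≤ h * M := mul_le_mul_of_nonneg_right hg (by positivity)
  have e3 : 0 ≤ g * A.card := mul_nonneg hg0 hA0
  have e4 : 0 ≤ h * M := by positivity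
  rw [abs_le]
  constructor <;> nlinarith [by1.1, by1.2, bM.1, bM.2]
end

section
/- Let g : ℕ → ℝ be a multiplicative function with g(d) ∈ [0,1] for all d ≥ 1, satisfying ∑_{p ≤ x, p prime} g(p) log p = log x + O(1) for x ≥ 2 and g(p) ≤ C/p for all primes p and some constant C ≥ 1. Let z₀ ≥ 2 be such that g(p) ≤ 1/2 for all primes p ≥ z₀. Then ∏_{z₀ ≤ p < z, p prime} (1 − g(p)) = exp(−log log z + O(1)) for z ≥ 3; in particular there are constants 0 < k₁ ≤ k₂ (depending on g and z₀) with k₁/log z ≤ ∏_{z₀ ≤ p < z} (1 − g(p)) ≤ k₂/log z for all z ≥ 3. -/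
open Finset Filter Real

open scoped Classical

lemma abel_aux (c : ℕ → ℝ) (M : ℝ)
    (h : ∀ m : ℕ, 2 ≤ m → |(∑ n ∈ Finset.Ico 2 (m+1), c n) - Real.log m| ≤ M) :
    ∃ K : ℝ, 0 ≤ K ∧ ∀ m : ℕ, 2 ≤ m →
      |(∑ n ∈ Finset.Ico 2 m, c n / Real.log n) - Real.log (Real.log m)| ≤ K := by
  set B : ℕ → ℝ := fun m => ∑ n ∈ Finset.Ico 2 m, c n with hB
  set S : ℕ → ℝ := fun m => ∑ n ∈ Finset.Ico 2 m, c n / Real.log n with hS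
  have hM0 : 0 ≤ M := (abs_nonneg _).trans (h 2 le_rfl)
  have hlogpos : ∀ m : ℕ, 2 ≤ m → 0 < Real.log m := fun m hm =>
    Real.log_pos (by exact_mod_cast hm)
  have hl2 : 0 < Real.log 2 := Real.log_pos (by norm_num)
  have hstep : ∀ m : ℕ, 2 ≤ m → Real.log ((m+1 : ℕ) : ℝ) ≤ Real.log m + Real.log 2 := by
    intro m hm
    have hm' : (2:ℝ) ≤ m := by exact_mod_cast hm
    rw [← Real.log_mul (by positivity) (by norm_num)]
    apply Real.log_le_log (by positivity)
    push_cast; linarith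
  have hstep' : ∀ m : ℕ, 2 ≤ m → Real.log m ≤ Real.log ((m+1 : ℕ) : ℝ) := by
    intro m hm
    have hm' : (2:ℝ) ≤ m := by exact_mod_cast hm
    apply Real.log_le_log (by positivity)
    push_cast; linarith
  set M' := M + Real.log 2 with hM'
  have hBB : ∀ m : ℕ, 2 ≤ m → |B m - Real.log m| ≤ M' := by
    intro m hm
    rcases Nat.lt_or_ge 2 m with h2 | h2
    · obtain ⟨k, rfl⟩ : ∃ k, m = k + 1 := ⟨m - 1, by omega⟩
      have := abs_le.1 (h k (by omega))
      have := hstep k (by omega)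
      have := hstep' k (by omega)
      simp only [hB]
      rw [abs_le]; constructor <;> linarith
    · obtain rfl : m = 2 := by omega
      simp [hB, abs_of_pos hl2, hM', hM0]
  have hBs : ∀ m : ℕ, 2 ≤ m → B (m+1) = B m + c m := fun m hm => by
    simp only [hB]; exact Finset.sum_Ico_succ_top hm _
  have hSs : ∀ m : ℕ, 2 ≤ m → S (m+1) = S m + c m / Real.log m := fun m hm => by
    simp only [hS]; exact Finset.sum_Ico_succ_top hm _
  have key : ∀ m : ℕ, 2 ≤ m →
      (S m - B m / Real.log m - Real.log (Real.log m) - M' / Real.log m ≥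
        - Real.log (Real.log 2) - M' / Real.log 2) ∧
      (S m - B m / Real.log m - Real.log (Real.log m) + M' / Real.log m ≤
        - Real.log (Real.log 2) + M' / Real.log 2) := by
    intro m hm
    induction m, hm using Nat.le_induction with
    | base => simp [hS, hB]
    | succ m hm ih =>
      have ha := hlogpos m hm
      have hb := hlogpos (m+1) (by omega)
      have h1 := abs_le.1 (h m hm)
      have h2 := hstep m hm
      have h3 := hstep' m hm
      have hBm : B (m+1) = ∑ n ∈ Finset.Ico 2 (m+1), c n := rfl
      rw [← hBm] at h1
      rw [hSs m hm]
      have hc : c m = B (m+1) - B m := by rw [hBs m hm]; ring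
      rw [hc]
      generalize Real.log ((m+1 : ℕ) : ℝ) = b at *
      generalize Real.log (m : ℝ) = a at *
      generalize B (m+1) = X at *
      have hδ : 0 ≤ 1 / a - 1 / b := by
        have := one_div_le_one_div_of_le ha h3
        linarith
      have e1 : Real.log b - Real.log a ≤ b / a - 1 := by
        rw [← Real.log_div hb.ne' ha.ne']
        exact Real.log_le_sub_one_of_pos (by positivity)
      have e2 : 1 - a / b ≤ Real.log b - Real.log a := by
        rw [← Real.log_div hb.ne' ha.ne']
        have := Real.one_sub_inv_le_log_of_pos (show 0 < b / a by positivity)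
        rwa [inv_div] at this
      have f1 : (b - M') * (1 / a - 1 / b) ≤ X * (1 / a - 1 / b) :=
        mul_le_mul_of_nonneg_right (by linarith) hδ
      have f2 : X * (1 / a - 1 / b) ≤ (a + M') * (1 / a - 1 / b) :=
        mul_le_mul_of_nonneg_right (by linarith) hδ
      have g1 : (b - M') * (1 / a - 1 / b) = b / a - 1 - M' / a + M' / b := by
        field_simp; ring
      have g2 : (a + M') * (1 / a - 1 / b) = 1 - a / b + M' / a - M' / b := by
        field_simp; ring
      have g3 : X * (1 / a - 1 / b) = X / a - X / b := by ring
      have g4 : (X - B m) / a = X / a - B m / a := by ring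
      rw [g4]
      constructor <;> linarith [ih.1, ih.2]
  have hM'0 : 0 ≤ M' := by positivity
  refine ⟨1 + |Real.log (Real.log 2)| + 3 * (M' / Real.log 2), by positivity, ?_⟩
  intro m hm
  have ha := hlogpos m hm
  obtain ⟨k1, k2⟩ := key m hm
  have h1 : |B m / Real.log m - 1| ≤ M' / Real.log m := by
    rw [show B m / Real.log m - 1 = (B m - Real.log m) / Real.log m by field_simp,
      abs_div, abs_of_pos ha]
    gcongr
    exact hBB m hm
  have h2 : M' / Real.log m ≤ M' / Real.log 2 := by
    gcongr
    exact_mod_cast hm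
  have h3 : 0 ≤ M' / Real.log m := by positivity
  have h4 := abs_le.1 h1
  have h5 := le_abs_self (Real.log (Real.log 2))
  have h6 := neg_abs_le (Real.log (Real.log 2))
  change |S m - _| ≤ _
  rw [abs_le]
  constructor <;> linarith

/-- Mertens-type product bound: under the stated hypotheses,
`∏_{z₀ ≤ p < z} (1 − g(p)) ≍ 1/log z` for `z ≥ 3`. -/
theorem sieve_product_bound (g : ℕ → ℝ) (hmul : MultOn g)
    (h01 : ∀ d : ℕ, 1 ≤ d → g d ∈ Set.Icc (0:ℝ) 1)
    (hM : ∃ M : ℝ, ∀ x : ℝ, 2 ≤ x →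
      |(∑ p ∈ (Finset.Icc 1 ⌊x⌋₊).filter Nat.Prime, g p * Real.log p) - Real.log x| ≤ M)
    (C : ℝ) (hC : 1 ≤ C) (hCp : ∀ p : ℕ, p.Prime → g p ≤ C / p)
    (z₀ : ℕ) (hz₀ : 2 ≤ z₀) (hhalf : ∀ p : ℕ, p.Prime → z₀ ≤ p → g p ≤ 1/2) :
    ∃ k₁ k₂ : ℝ, 0 < k₁ ∧ k₁ ≤ k₂ ∧ ∀ z : ℝ, 3 ≤ z →
      k₁ / Real.log z ≤ (∏ p ∈ (Finset.Ico z₀ ⌈z⌉₊).filter Nat.Prime, (1 - g p)) ∧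
      (∏ p ∈ (Finset.Ico z₀ ⌈z⌉₊).filter Nat.Prime, (1 - g p)) ≤ k₂ / Real.log z := by
  obtain ⟨M, hM⟩ := hM
  set f : ℕ → ℝ := fun n => if n.Prime then g n else 0 with hf
  have hf0 : ∀ n, 0 ≤ f n := by
    intro n
    simp only [hf]
    split_ifs with hp
    · exact (h01 n hp.one_lt.le).1
    · exact le_rfl
  have hf2 : ∀ n, f n ^ 2 ≤ C ^ 2 * (1 / (n:ℝ) ^ 2) := by
    intro n
    simp only [hf]
    split_ifs with hp
    · have := hCp n hp
      have h0 := (h01 n hp.one_lt.le).1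
      calc g n ^ 2 ≤ (C / n) ^ 2 := by gcongr
        _ = _ := by ring
    · simp only [ne_eq, OfNat.ofNat_ne_zero, not_false_eq_true, zero_pow]; positivity
  obtain ⟨K, hK0, hK⟩ := abel_aux (fun n => f n * Real.log n) M (by
    intro m hm
    have h1 := hM m (by exact_mod_cast hm)
    rw [Nat.floor_natCast, Finset.sum_filter] at h1
    convert h1 using 3
    have : Finset.Icc 1 m = insert 1 (Finset.Ico 2 (m+1)) := by
      ext x; simp; omega
    rw [this, Finset.sum_insert (by simp)]
    simp [hf, Nat.not_prime_one, ite_mul])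
  have hS : ∀ m : ℕ, ∑ n ∈ Finset.Ico 2 m, f n * Real.log n / Real.log n
      = ∑ n ∈ Finset.Ico 2 m, f n := by
    intro m
    apply Finset.sum_congr rfl
    intro n hn
    have : 0 < Real.log n := Real.log_pos (by exact_mod_cast (Finset.mem_Ico.1 hn).1)
    field_simp
  simp only [hS] at hK
  have hsum : Summable (fun n : ℕ => C ^ 2 * (1 / (n:ℝ) ^ 2)) :=
    (Real.summable_one_div_nat_pow.2 (by norm_num)).mul_left _
  set Z := ∑' n : ℕ, C ^ 2 * (1 / (n:ℝ) ^ 2) with hZ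
  set S₀ := ∑ n ∈ Finset.Ico 2 z₀, f n with hS₀
  have main : ∀ z : ℝ, 3 ≤ z →
      (Real.exp (-K - 2 * Z) / 2) / Real.log z ≤
        (∏ p ∈ (Finset.Ico z₀ ⌈z⌉₊).filter Nat.Prime, (1 - g p)) ∧
      (∏ p ∈ (Finset.Ico z₀ ⌈z⌉₊).filter Nat.Prime, (1 - g p)) ≤
        Real.exp (S₀ + K) / Real.log z := by
    intro z hz
    set m := ⌈z⌉₊ with hm
    have hzm : z ≤ m := Nat.le_ceil z
    have hmz : (m:ℝ) < z + 1 := Nat.ceil_lt_add_one (by linarith)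
    have hm2 : 2 ≤ m := by
      have : (2:ℝ) ≤ m := by linarith
      exact_mod_cast this
    have hlz : 0 < Real.log z := Real.log_pos (by linarith)
    have hlm : 0 < Real.log m := Real.log_pos (by linarith)
    have hl1 : Real.log z ≤ Real.log m := Real.log_le_log (by linarith) hzm
    have hl2 : Real.log m ≤ 2 * Real.log z := by
      have : Real.log m ≤ Real.log (z ^ 2) :=
        Real.log_le_log (by linarith) (by nlinarith)
      rwa [Real.log_pow] at this
    have hKm := abs_le.1 (hK m hm2)
    have hprod : (∏ p ∈ (Finset.Ico z₀ m).filter Nat.Prime, (1 - g p))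
        = ∏ p ∈ Finset.Ico z₀ m, (1 - f p) := by
      rw [Finset.prod_filter]
      apply Finset.prod_congr rfl
      intro n _
      simp only [hf]
      split_ifs <;> simp
    have hfh : ∀ n ∈ Finset.Ico z₀ m, f n ≤ 1 / 2 := by
      intro n hn
      simp only [hf]
      split_ifs with hp
      · exact hhalf n hp (Finset.mem_Ico.1 hn).1
      · norm_num
    have hsub1 : ∑ n ∈ Finset.Ico z₀ m, f n ≤ ∑ n ∈ Finset.Ico 2 m, f n :=
      Finset.sum_le_sum_of_subset_of_nonneg
        (Finset.Ico_subset_Ico_left hz₀) (fun n _ _ => hf0 n)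
    have hsub2 : ∑ n ∈ Finset.Ico 2 m, f n ≤ S₀ + ∑ n ∈ Finset.Ico z₀ m, f n := by
      rw [hS₀, ← Finset.sum_union (Finset.Ico_disjoint_Ico_consecutive _ _ _)]
      apply Finset.sum_le_sum_of_subset_of_nonneg _ (fun n _ _ => hf0 n)
      intro x; simp; omega
    have hZs : ∑ n ∈ Finset.Ico z₀ m, f n ^ 2 ≤ Z :=
      (Finset.sum_le_sum (fun n _ => hf2 n)).trans
        (hsum.sum_le_tsum _ (fun n _ => by positivity))
    rw [hprod]
    constructor
    · have h1 : ∏ p ∈ Finset.Ico z₀ m, Real.exp (-(f p + 2 * f p ^ 2)) ≤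
          ∏ p ∈ Finset.Ico z₀ m, (1 - f p) := by
        apply Finset.prod_le_prod (fun _ _ => (Real.exp_pos _).le)
        intro n hn
        have a1 := hfh n hn
        have a2 := hf0 n
        have hpos : 0 < 1 - f n := by linarith
        rw [← Real.le_log_iff_exp_le hpos]
        refine le_trans ?_ (Real.one_sub_inv_le_log_of_pos hpos)
        have : (1 - f n)⁻¹ ≤ 1 + (f n + 2 * f n ^ 2) := by
          rw [inv_le_iff_one_le_mul₀ hpos]
          nlinarith [mul_nonneg (sq_nonneg (f n)) (by linarith : 0 ≤ 1 - 2 * f n)]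
        linarith
      rw [← Real.exp_sum, Finset.sum_neg_distrib, Finset.sum_add_distrib, ← Finset.mul_sum] at h1
      refine le_trans ?_ h1
      calc Real.exp (-K - 2 * Z) / 2 / Real.log z
          = Real.exp (-K - 2 * Z) / (2 * Real.log z) := by rw [div_div]
        _ ≤ Real.exp (-K - 2 * Z) / Real.log m := by gcongr
        _ = Real.exp (-K - 2 * Z - Real.log (Real.log m)) := by
            rw [Real.exp_sub (-K - 2 * Z), Real.exp_log hlm]
        _ ≤ _ := by
            apply Real.exp_le_exp.2
            linarith
    · have h1 : ∏ p ∈ Finset.Ico z₀ m, (1 - f p) ≤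
          ∏ p ∈ Finset.Ico z₀ m, Real.exp (-(f p)) := by
        apply Finset.prod_le_prod
        · intro n hn
          have := hfh n hn
          linarith
        · intro n hn
          exact Real.one_sub_le_exp_neg _
      rw [← Real.exp_sum, Finset.sum_neg_distrib] at h1
      refine h1.trans ?_
      calc _ ≤ Real.exp (S₀ + K - Real.log (Real.log m)) := by
            apply Real.exp_le_exp.2
            linarith
        _ = Real.exp (S₀ + K) / Real.log m := by
            rw [Real.exp_sub, Real.exp_log hlm]
        _ ≤ _ := by gcongr
  refine ⟨Real.exp (-K - 2 * Z) / 2, Real.exp (S₀ + K), by positivity, ?_, main⟩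
  have h3 := main 3 le_rfl
  have := h3.1.trans h3.2
  have hl : 0 < Real.log 3 := Real.log_pos (by norm_num)
  exact (div_le_div_iff_of_pos_right hl).1 this
end
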